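/- Under the standard assumptions, suppose H_a and H_b are any Kuratowski subgraphs of G avoiding a and b respectively. (1) If v ∈ V(H_a) \ (V(H_b) ∪ {a,b}), then v and all neighbors of v in G are branch vertices of H_a. (2) If v ∈ V(H_b) \ (V(H_a) ∪ {a,b}), then v and all neighbors of v in G are branch vertices of H_b. -/

import Mathlib

open SimpleGraph

/-- The complete graph on five vertices. -/
def K5 : SimpleGraph (Fin 5) := ⊤

/-- The complete bipartite graph `K_{3,3}`. -/
def K33 : SimpleGraph (Fin 6) :=
  SimpleGraph.fromRel (fun i j => i.val < 3 ∧ 3 ≤ j.val)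

/-- `K_{3,3}` plus one extra edge joining two vertices in the same part. -/
def K33e : SimpleGraph (Fin 6) :=
  SimpleGraph.fromRel (fun i j => (i.val < 3 ∧ 3 ≤ j.val) ∨ (i.val = 0 ∧ j.val = 1))

/-- `H` is a minor of `G`, witnessed by a family of nonempty, connected,
pairwise disjoint branch sets together with edges between the branch sets of
adjacent vertices of `H`. -/
def SimpleGraph.IsMinorOf {W V : Type} (H : SimpleGraph W) (G : SimpleGraph V) : Prop :=
  ∃ f : W → Set V,
    (∀ w, (G.induce (f w)).Connected) ∧
    (Pairwise fun w w' => Disjoint (f w) (f w')) ∧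
    (∀ ⦃w w'⦄, H.Adj w w' → ∃ u ∈ f w, ∃ v ∈ f w', G.Adj u v)

/-- Planarity, via the Kuratowski–Wagner characterization: a (finite simple) graph is
planar iff it has no `K₅` minor and no `K_{3,3}` minor. -/
def IsPlanar {V : Type} (G : SimpleGraph V) : Prop :=
  ¬ K5.IsMinorOf G ∧ ¬ K33.IsMinorOf G

/-- A graph is apex if it is planar or some vertex deletion makes it planar. -/
def IsApex {V : Type} (G : SimpleGraph V) : Prop :=
  IsPlanar G ∨ ∃ v : V, IsPlanar (G.induce {u | u ≠ v})

/-- `G` is an obstruction for the apex family: it is not apex, but every minor of it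
that is not isomorphic to it is apex. -/
def IsApexObstruction {V : Type} (G : SimpleGraph V) : Prop :=
  ¬ IsApex G ∧
    ∀ (W : Type) (H : SimpleGraph W), H.IsMinorOf G → IsEmpty (H ≃g G) → IsApex H

/-- Subdivide the edge `uv` of `G`: the new vertex is `none`. -/
def subdivideEdge {V : Type} (G : SimpleGraph V) (u v : V) : SimpleGraph (Option V) :=
  SimpleGraph.fromRel (fun x y =>
    (∃ a b, x = some a ∧ y = some b ∧ G.Adj a b ∧ s(a, b) ≠ s(u, v)) ∨
    (x = none ∧ (y = some u ∨ y = some v)))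

/-- `IsSubdivision G H` : `H` is (isomorphic to) a graph obtained from `G` by repeatedly
subdividing edges. -/
inductive IsSubdivision : {V : Type} → SimpleGraph V → {W : Type} → SimpleGraph W → Prop
  | of_iso {V W : Type} {G : SimpleGraph V} {H : SimpleGraph W} :
      (G ≃g H) → IsSubdivision G H
  | step {V W U : Type} {G : SimpleGraph V} {H : SimpleGraph W} {u v : W}
      {H' : SimpleGraph U} :
      H.Adj u v → IsSubdivision G H → (subdivideEdge H u v ≃g H') → IsSubdivision G H'

/-- A Kuratowski subgraph of `G` is a subgraph that is a subdivision of `K₅` or `K_{3,3}`. -/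
def IsKuratowski {V : Type} {G : SimpleGraph V} (H : G.Subgraph) : Prop :=
  IsSubdivision K5 H.coe ∨ IsSubdivision K33 H.coe

/-- A Kuratowski witness for `v` is a Kuratowski subgraph of `G` avoiding `v`. -/
def IsKuratowskiWitness {V : Type} (G : SimpleGraph V) (v : V) (H : G.Subgraph) : Prop :=
  IsKuratowski H ∧ v ∉ H.verts

/-- A branch vertex of a (Kuratowski) subgraph: a vertex of degree at least 3 in it. -/
def IsBranchVertex {V : Type} {G : SimpleGraph V} (H : G.Subgraph) (x : V) : Prop :=
  x ∈ H.verts ∧ 3 ≤ (H.neighborSet x).ncard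

/-- The vertex connectivity of a finite graph: the largest `k` such that deleting any
fewer than `k` vertices leaves a connected graph. -/
noncomputable def vConn {V : Type} [Fintype V] (G : SimpleGraph V) : ℕ :=
  sSup {k : ℕ | ∀ s : Finset V, s.card < k → (G.induce ((↑s : Set V)ᶜ)).Connected}

/-- A 2-cut: a set of two vertices whose deletion disconnects the graph. -/
def IsTwoCut {V : Type} (G : SimpleGraph V) (S : Set V) : Prop :=
  S.ncard = 2 ∧ ¬ (G.induce Sᶜ).Preconnected

/-- `C` is (the vertex set of) a connected component of `G − S`. -/
def IsCompOf {V : Type} (G : SimpleGraph V) (S : Set V) (C : Set V) : Prop :=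
  C.Nonempty ∧ Disjoint C S ∧ (G.induce C).Connected ∧
    ∀ u ∈ C, ∀ v, v ∉ S → G.Adj u v → v ∈ C

/-- The augmented component `C⁺`: the subgraph induced by `C ∪ S` together with all
edges joining vertices of `S`. -/
def augment {V : Type} (G : SimpleGraph V) (S C : Set V) : SimpleGraph ↥(C ∪ S) :=
  SimpleGraph.fromRel (fun u v => G.Adj (u : V) (v : V) ∨ ((u : V) ∈ S ∧ (v : V) ∈ S))

/-- `C` is a heavy component for the 2-cut `{a,b}`: a component of `G − {a,b}` whose
augmentation contains Kuratowski witnesses for both `a` and `b`. -/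
def IsHeavyComp {V : Type} (G : SimpleGraph V) (a b : V) (C : Set V) : Prop :=
  IsCompOf G {a, b} C ∧
    (∃ Ha : G.Subgraph, IsKuratowskiWitness G a Ha ∧ Ha.verts ⊆ C ∪ {a, b}) ∧
    (∃ Hb : G.Subgraph, IsKuratowskiWitness G b Hb ∧ Hb.verts ⊆ C ∪ {a, b})

/-- `{a,b}` is a basic 2-cut with heavy component `C`: a 2-cut whose heavy-component
weight is minimum among all 2-cuts. -/
def IsBasic2Cut {V : Type} (G : SimpleGraph V) (a b : V) (C : Set V) : Prop :=
  IsTwoCut G {a, b} ∧ IsHeavyComp G a b C ∧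
    ∀ c d : V, ∀ D : Set V, IsTwoCut G {c, d} → IsHeavyComp G c d D → C.ncard ≤ D.ncard

/-- The subgraph of `G` induced by `A`, kept on the same vertex set (vertices outside `A`
become isolated). -/
def restrictTo {V : Type} (G : SimpleGraph V) (A : Set V) : SimpleGraph V :=
  SimpleGraph.fromRel (fun u v => G.Adj u v ∧ u ∈ A ∧ v ∈ A)

/-- Contract the edge `uv` of `G`, keeping the label `u` for the merged vertex
(`v` becomes isolated). -/
def contractEdge {V : Type} (G : SimpleGraph V) (u v : V) : SimpleGraph V :=
  SimpleGraph.fromRel (fun x y =>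
    x ≠ v ∧ y ≠ v ∧ (G.Adj x y ∨ (x = u ∧ G.Adj v y) ∨ (y = u ∧ G.Adj x v)))

/-- `T` separates `a` from `b` in `G`: `a, b ∉ T` and every walk from `a` to `b`
meets `T`. -/
def Separates {V : Type} (G : SimpleGraph V) (T : Set V) (a b : V) : Prop :=
  a ∉ T ∧ b ∉ T ∧ ∀ p : G.Walk a b, ∃ t ∈ T, t ∈ p.support

/-- Disjoint union of two graphs. -/
def disjUnion {V W : Type} (G : SimpleGraph V) (H : SimpleGraph W) : SimpleGraph (V ⊕ W) :=
  SimpleGraph.fromRel (fun x y =>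
    (∃ a b, x = Sum.inl a ∧ y = Sum.inl b ∧ G.Adj a b) ∨
    (∃ a b, x = Sum.inr a ∧ y = Sum.inr b ∧ H.Adj a b))

/-- The graph on `Fin n` with the given list of edges. -/
def graphOfList (n : ℕ) (l : List (ℕ × ℕ)) : SimpleGraph (Fin n) :=
  SimpleGraph.fromRel (fun i j => ((i : ℕ), (j : ℕ)) ∈ l)

/-- A graph is 2-connected: at least three vertices and no cut vertex. -/
def IsTwoConnectedGraph {U : Type} (H : SimpleGraph U) : Prop :=
  3 ≤ Nat.card U ∧ ∀ u : U, (H.induce {x | x ≠ u}).Connected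

/-- `y` can be reached from `x` in `G` by steps with both ends in `S`. -/
def ReachIn {V : Type} (G : SimpleGraph V) (S : Set V) : V → V → Prop :=
  Relation.ReflTransGen fun p q => G.Adj p q ∧ p ∈ S ∧ q ∈ S

/-- `S` is nonempty and connected in `G`. -/
def ConnOn {V : Type} (G : SimpleGraph V) (S : Set V) : Prop :=
  S.Nonempty ∧ ∀ x ∈ S, ∀ y ∈ S, ReachIn G S x y

namespace ReachIn

variable {V V' : Type} {G G' : SimpleGraph V} {S T : Set V} {x y z : V}

theorem refl (x : V) : ReachIn G S x x := Relation.ReflTransGen.refl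

theorem trans (h : ReachIn G S x y) (h' : ReachIn G S y z) : ReachIn G S x z :=
  Relation.ReflTransGen.trans h h'

theorem symm (h : ReachIn G S x y) : ReachIn G S y x := by
  induction h with
  | refl => exact refl _
  | tail _ h ih => exact trans (Relation.ReflTransGen.single ⟨h.1.symm, h.2.2, h.2.1⟩) ih

theorem of_adj (h : G.Adj x y) (hx : x ∈ S) (hy : y ∈ S) : ReachIn G S x y :=
  Relation.ReflTransGen.single ⟨h, hx, hy⟩

theorem map {G' : SimpleGraph V'} {T : Set V'} (φ : V → V')
    (hφ : ∀ p ∈ S, ∀ q ∈ S, G.Adj p q → ReachIn G' T (φ p) (φ q))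
    (h : ReachIn G S x y) : ReachIn G' T (φ x) (φ y) := by
  induction h with
  | refl => exact refl _
  | tail _ h ih => exact ih.trans (hφ _ h.2.1 _ h.2.2 h.1)

theorem mono (hG : ∀ p ∈ S, ∀ q ∈ S, G.Adj p q → G'.Adj p q) (hS : S ⊆ T)
    (h : ReachIn G S x y) : ReachIn G' T x y :=
  h.map id fun p hp q hq hpq => of_adj (hG p hp q hq hpq) (hS hp) (hS hq)

end ReachIn

section Conn

variable {V V' : Type}

theorem preconnected_induce_iff_reachIn {G : SimpleGraph V} {S : Set V} :
    (G.induce S).Preconnected ↔ ∀ x ∈ S, ∀ y ∈ S, ReachIn G S x y := by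
  constructor
  · intro h x hx y hy
    have h1 := (SimpleGraph.reachable_iff_reflTransGen _ _).1 (h ⟨x, hx⟩ ⟨y, hy⟩)
    have key : ∀ z : S, Relation.ReflTransGen (G.induce S).Adj ⟨x, hx⟩ z → ReachIn G S x z := by
      intro z h
      induction h with
      | refl => exact ReachIn.refl _
      | tail _ h ih => exact ih.trans (ReachIn.of_adj h (Subtype.coe_prop _) (Subtype.coe_prop _))
    exact key _ h1
  · rintro h ⟨x, hx⟩ ⟨y, hy⟩
    have key : ∀ z, ReachIn G S x z → ∀ hz : z ∈ S,
        (G.induce S).Reachable ⟨x, hx⟩ ⟨z, hz⟩ := by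
      intro z h
      induction h with
      | refl => intro hz; exact SimpleGraph.Reachable.refl _
      | tail _ h ih =>
        intro hz
        refine (ih h.2.1).trans (SimpleGraph.Adj.reachable ?_)
        exact h.1
    exact key y (h x hx y hy) hy

theorem connected_induce_iff_connOn {G : SimpleGraph V} {S : Set V} :
    (G.induce S).Connected ↔ ConnOn G S := by
  rw [SimpleGraph.connected_iff, preconnected_induce_iff_reachIn, Set.nonempty_coe_sort]
  exact and_comm

theorem ConnOn.singleton (G : SimpleGraph V) (x : V) : ConnOn G {x} := by
  refine ⟨⟨x, rfl⟩, ?_⟩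
  rintro _ rfl _ rfl
  exact ReachIn.refl _

theorem ConnOn.of_center {G : SimpleGraph V} {S : Set V} {c : V} (hc : c ∈ S)
    (h : ∀ x ∈ S, ReachIn G S c x) : ConnOn G S :=
  ⟨⟨c, hc⟩, fun x hx y hy => (h x hx).symm.trans (h y hy)⟩

theorem ConnOn.image {G : SimpleGraph V} {G' : SimpleGraph V'} {A : Set V} (φ : V → V')
    (hφ : ∀ p ∈ A, ∀ q ∈ A, G.Adj p q → φ p = φ q ∨ G'.Adj (φ p) (φ q))
    (h : ConnOn G A) : ConnOn G' (φ '' A) := by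
  refine ⟨h.1.image _, ?_⟩
  rintro _ ⟨x, hx, rfl⟩ _ ⟨y, hy, rfl⟩
  refine (h.2 x hx y hy).map φ fun p hp q hq hpq => ?_
  rcases hφ p hp q hq hpq with h | h
  · rw [h]; exact ReachIn.refl _
  · exact ReachIn.of_adj h ⟨p, hp, rfl⟩ ⟨q, hq, rfl⟩

theorem ConnOn.mono_graph {G G' : SimpleGraph V} {A : Set V} (hG : G ≤ G')
    (h : ConnOn G A) : ConnOn G' A :=
  ⟨h.1, fun x hx y hy => (h.2 x hx y hy).mono (fun _ _ _ _ h => hG h) subset_rfl⟩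

theorem ConnOn.preimage {G : SimpleGraph V} {G' : SimpleGraph V'} (φ : G' ↪g G) {A : Set V}
    (hA : A ⊆ Set.range φ) (h : ConnOn G A) : ConnOn G' (φ ⁻¹' A) := by
  obtain ⟨⟨x, hx⟩, h⟩ := h
  obtain ⟨x, rfl⟩ := hA hx
  refine ConnOn.of_center (c := x) hx fun y hy => ?_
  have key : ∀ z, ReachIn G A (φ x) z → ∀ y, φ y = z → ReachIn G' (φ ⁻¹' A) x y := by
    intro z h
    induction h with
    | refl => intro y hy; rw [φ.injective hy]; exact ReachIn.refl _
    | tail _ h ih =>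
      rintro y rfl
      obtain ⟨p, rfl⟩ := hA h.2.1
      exact (ih p rfl).trans (ReachIn.of_adj (φ.map_adj_iff.1 h.1) h.2.1 h.2.2)
  exact key _ (h _ hx _ hy) y rfl

/-- A set closed under adjacency inside `S` contains everything reachable from it. -/
theorem ReachIn.mem_of_closed {G : SimpleGraph V} {S T : Set V} {x y : V}
    (h : ReachIn G S x y) (hx : x ∈ T)
    (hT : ∀ p ∈ T, ∀ q ∈ S, p ∈ S → G.Adj p q → q ∈ T) : y ∈ T := by
  induction h with
  | refl => exact hx
  | tail _ h ih => exact hT _ ih _ h.2.2 h.2.1 h.1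

end Conn

/-- Branch sets of a `K`-minor of `G`. -/
structure Model {W V : Type} (K : SimpleGraph W) (G : SimpleGraph V) (f : W → Set V) : Prop where
  conn : ∀ w, ConnOn G (f w)
  disj : ∀ ⦃w w' x⦄, x ∈ f w → x ∈ f w' → w = w'
  adj : ∀ ⦃w w'⦄, K.Adj w w' → ∃ u ∈ f w, ∃ v ∈ f w', G.Adj u v

section Minors

variable {W V V' : Type} {K : SimpleGraph W} {G : SimpleGraph V}

theorem isMinorOf_iff_model : K.IsMinorOf G ↔ ∃ f, Model K G f := by
  constructor
  · rintro ⟨f, h1, h2, h3⟩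
    refine ⟨f, fun w => connected_induce_iff_connOn.1 (h1 w), fun w w' x hx hx' => ?_, h3⟩
    by_contra hne
    exact Set.disjoint_left.1 (h2 hne) hx hx'
  · rintro ⟨f, h⟩
    refine ⟨f, fun w => connected_induce_iff_connOn.2 (h.conn w), fun w w' hne => ?_, h.adj⟩
    exact Set.disjoint_left.2 fun x hx hx' => hne (h.disj hx hx')

theorem Model.bind {G' : SimpleGraph V'} {f : W → Set V} (h : Model K G f) (g : V → Set V')
    {U : Set V} (hU : ∀ w, f w ⊆ U) (hconn : ∀ x ∈ U, ConnOn G' (g x))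
    (hdisj : ∀ x ∈ U, ∀ y ∈ U, ∀ z, z ∈ g x → z ∈ g y → x = y)
    (hadj : ∀ x ∈ U, ∀ y ∈ U, G.Adj x y → ∃ u ∈ g x, ∃ v ∈ g y, G'.Adj u v) :
    Model K G' fun w => ⋃ x ∈ f w, g x := by
  refine ⟨fun w => ⟨?_, ?_⟩, ?_, ?_⟩
  · obtain ⟨x, hx⟩ := (h.conn w).1
    obtain ⟨u, hu⟩ := (hconn x (hU w hx)).1
    exact ⟨u, Set.mem_biUnion hx hu⟩
  · intro u hu v hv
    simp only [Set.mem_iUnion] at hu hv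
    obtain ⟨x, hx, hu⟩ := hu
    obtain ⟨y, hy, hv⟩ := hv
    have inside : ∀ x ∈ f w, ∀ u ∈ g x, ∀ v ∈ g x, ReachIn G' (⋃ x ∈ f w, g x) u v :=
      fun x hx u hu v hv => ((hconn x (hU w hx)).2 u hu v hv).mono (fun _ _ _ _ h => h)
        (Set.subset_biUnion_of_mem (u := g) hx)
    have key : ∀ y, ReachIn G (f w) x y → ∀ v ∈ g y,
        y ∈ f w → ReachIn G' (⋃ x ∈ f w, g x) u v := by
      intro y hxy
      induction hxy with
      | refl => intro v hv _; exact inside x hx u hu v hv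
      | @tail b c _ hbc ih =>
        intro v hv _
        obtain ⟨s, hs, t, ht, hst⟩ := hadj b (hU w hbc.2.1) c (hU w hbc.2.2) hbc.1
        refine ((ih s hs hbc.2.1).trans (ReachIn.of_adj hst ?_ ?_)).trans
          (inside c hbc.2.2 t ht v hv)
        · exact Set.mem_biUnion hbc.2.1 hs
        · exact Set.mem_biUnion hbc.2.2 ht
    exact key y ((h.conn w).2 x hx y hy) v hv hy
  · intro w w' u hu hv
    simp only [Set.mem_iUnion] at hu hv
    obtain ⟨x, hx, hu⟩ := hu
    obtain ⟨y, hy, hv⟩ := hv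
    have := hdisj x (hU w hx) y (hU w' hy) u hu hv
    subst this
    exact h.disj hx hy
  · intro w w' hww
    obtain ⟨x, hx, y, hy, hxy⟩ := h.adj hww
    obtain ⟨s, hs, t, ht, hst⟩ := hadj x (hU w hx) y (hU w' hy) hxy
    exact ⟨s, Set.mem_biUnion hx hs, t, Set.mem_biUnion hy ht, hst⟩

theorem Model.image {G' : SimpleGraph V'} {f : W → Set V} (h : Model K G f) (φ : V → V')
    (hadj : ∀ x y, G.Adj x y → φ x = φ y ∨ G'.Adj (φ x) (φ y))
    (hinj : ∀ w w', w ≠ w' → ∀ x ∈ f w, ∀ y ∈ f w', φ x ≠ φ y) :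
    Model K G' fun w => φ '' f w := by
  refine ⟨fun w => (h.conn w).image φ fun p _ q _ => hadj p q, ?_, ?_⟩
  · rintro w w' _ ⟨x, hx, rfl⟩ ⟨y, hy, hxy⟩
    by_contra hne
    exact hinj w w' hne x hx y hy hxy.symm
  · intro w w' hww
    obtain ⟨x, hx, y, hy, hxy⟩ := h.adj hww
    refine ⟨_, ⟨x, hx, rfl⟩, _, ⟨y, hy, rfl⟩, ?_⟩
    exact (hadj x y hxy).resolve_left (hinj w w' hww.ne x hx y hy)

theorem Model.preimage {G' : SimpleGraph V'} {f : W → Set V} (h : Model K G f) (φ : G' ↪g G)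
    (hf : ∀ w, f w ⊆ Set.range φ) : Model K G' fun w => φ ⁻¹' f w := by
  refine ⟨fun w => (h.conn w).preimage φ (hf w), fun w w' x hx hx' => h.disj hx hx', ?_⟩
  intro w w' hww
  obtain ⟨x, hx, y, hy, hxy⟩ := h.adj hww
  obtain ⟨x, rfl⟩ := hf _ hx
  obtain ⟨y, rfl⟩ := hf _ hy
  exact ⟨x, hx, y, hy, φ.map_adj_iff.1 hxy⟩

theorem SimpleGraph.IsMinorOf.trans {G' : SimpleGraph V'} (h : K.IsMinorOf G)
    (h' : G.IsMinorOf G') : K.IsMinorOf G' := by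
  rw [isMinorOf_iff_model] at *
  obtain ⟨f, hf⟩ := h
  obtain ⟨g, hg⟩ := h'
  exact ⟨_, hf.bind g (U := Set.univ) (fun _ => Set.subset_univ _) (fun x _ => hg.conn x)
    (fun x _ y _ z hx hy => hg.disj hx hy) fun x _ y _ hxy => hg.adj hxy⟩

theorem isMinorOf_of_hom {G' : SimpleGraph V'} (φ : V → V') (hφ : Function.Injective φ)
    (h : ∀ x y, G.Adj x y → G'.Adj (φ x) (φ y)) : G.IsMinorOf G' := by
  rw [isMinorOf_iff_model]
  refine ⟨fun x => {φ x}, fun x => ConnOn.singleton _ _, ?_, ?_⟩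
  · rintro x y _ rfl hy
    exact hφ hy
  · intro x y hxy
    exact ⟨_, rfl, _, rfl, h x y hxy⟩

theorem isMinorOf_subdivideEdge (u v : V) : G.IsMinorOf (subdivideEdge G u v) := by
  rw [isMinorOf_iff_model]
  refine ⟨fun x => {z | z = some x ∨ (z = none ∧ x = u)}, ?_, ?_, ?_⟩
  · intro x
    refine ConnOn.of_center (c := some x) (Or.inl rfl) ?_
    rintro z (rfl | ⟨rfl, rfl⟩)
    · exact ReachIn.refl _
    · refine ReachIn.of_adj ?_ (Or.inl rfl) (Or.inr ⟨rfl, rfl⟩)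
      simp [subdivideEdge]
  · rintro x y z (rfl | ⟨rfl, rfl⟩) (h | ⟨h, h'⟩)
    · simpa using h
    · simp at h
    · simp at h
    · exact h'.symm
  · intro x y hxy
    by_cases he : s(x, y) = s(u, v)
    · rcases Sym2.eq_iff.1 he with ⟨rfl, rfl⟩ | ⟨rfl, rfl⟩
      · exact ⟨none, Or.inr ⟨rfl, rfl⟩, some y, Or.inl rfl, by simp [subdivideEdge]⟩
      · exact ⟨some x, Or.inl rfl, none, Or.inr ⟨rfl, rfl⟩, by simp [subdivideEdge]⟩
    · refine ⟨some x, Or.inl rfl, some y, Or.inl rfl, ?_⟩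
      simp only [subdivideEdge, SimpleGraph.fromRel_adj]
      exact ⟨by simpa using hxy.ne, Or.inl (Or.inl ⟨x, y, rfl, rfl, hxy, he⟩)⟩

theorem IsSubdivision.isMinorOf {V W : Type} {G : SimpleGraph V} {H : SimpleGraph W}
    (h : IsSubdivision G H) : G.IsMinorOf H := by
  induction h with
  | of_iso e => exact isMinorOf_of_hom e e.injective fun x y h => e.map_adj_iff.2 h
  | step _ _ e ih =>
    exact (ih.trans (isMinorOf_subdivideEdge _ _)).trans
      (isMinorOf_of_hom e e.injective fun x y h => e.map_adj_iff.2 h)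

end Minors

/-- No cut vertex, and at least three vertices. -/
structure TwoConn {V : Type} (G : SimpleGraph V) : Prop where
  conn : ∀ x, ConnOn G {x}ᶜ
  big : ∀ x y : V, ∃ t, t ≠ x ∧ t ≠ y

theorem TwoConn.of_iso {V W : Type} {G : SimpleGraph V} {H : SimpleGraph W} (h : TwoConn G)
    (e : G ≃g H) : TwoConn H := by
  refine ⟨fun x => ?_, fun x y => ?_⟩
  · have := (h.conn (e.symm x)).image (G' := H) e fun p _ q _ hpq => Or.inr (e.map_adj_iff.2 hpq)
    convert this using 1
    ext z
    simp only [Set.mem_compl_iff, Set.mem_singleton_iff, Set.mem_image]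
    constructor
    · intro hz
      exact ⟨e.symm z, fun h => hz (e.symm.injective h), e.apply_symm_apply z⟩
    · rintro ⟨p, hp, rfl⟩ rfl
      exact hp (e.symm_apply_apply p).symm
  · obtain ⟨t, h1, h2⟩ := h.big (e.symm x) (e.symm y)
    refine ⟨e t, ?_, ?_⟩
    · rintro rfl; exact h1 (e.symm_apply_apply t).symm
    · rintro rfl; exact h2 (e.symm_apply_apply t).symm

theorem TwoConn.subdivideEdge {V : Type} {G : SimpleGraph V} (h : TwoConn G) {u v : V}
    (huv : G.Adj u v) : TwoConn (subdivideEdge G u v) := by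
  have adj1 : (_root_.subdivideEdge G u v).Adj (some u) none := by simp [_root_.subdivideEdge]
  have adj2 : (_root_.subdivideEdge G u v).Adj none (some v) := by simp [_root_.subdivideEdge]
  have adj3 : ∀ p q, G.Adj p q → s(p, q) ≠ s(u, v) →
      (_root_.subdivideEdge G u v).Adj (some p) (some q) := by
    intro p q hpq he
    simp only [_root_.subdivideEdge, SimpleGraph.fromRel_adj]
    exact ⟨by simpa using hpq.ne, Or.inl (Or.inl ⟨p, q, rfl, rfl, hpq, he⟩)⟩
  have lift : ∀ x p q, p ≠ x → q ≠ x →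
      ReachIn (_root_.subdivideEdge G u v) {some x}ᶜ (some p) (some q) := by
    intro x p q hp hq
    refine ((h.conn x).2 p hp q hq).map some fun s hs t ht hst => ?_
    have hs' : some s ∈ ({some x}ᶜ : Set (Option V)) := by simpa using hs
    have ht' : some t ∈ ({some x}ᶜ : Set (Option V)) := by simpa using ht
    have hn : none ∈ ({some x}ᶜ : Set (Option V)) := by simp
    by_cases he : s(s, t) = s(u, v)
    · rcases Sym2.eq_iff.1 he with ⟨rfl, rfl⟩ | ⟨rfl, rfl⟩
      · exact (ReachIn.of_adj adj1 hs' hn).trans (ReachIn.of_adj adj2 hn ht')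
      · exact (ReachIn.of_adj adj2.symm hs' hn).trans (ReachIn.of_adj adj1.symm hn ht')
    · exact ReachIn.of_adj (adj3 s t hst he) hs' ht'
  have noedge : ∀ x p q, p ≠ x → q ≠ x → (x = u ∨ x = v) →
      ReachIn (_root_.subdivideEdge G u v) {none}ᶜ (some p) (some q) := by
    intro x p q hp hq hx
    refine ((h.conn x).2 p hp q hq).map some fun s hs t ht hst => ?_
    refine ReachIn.of_adj (adj3 s t hst ?_) (by simp) (by simp)
    intro he
    rcases Sym2.eq_iff.1 he with ⟨rfl, rfl⟩ | ⟨rfl, rfl⟩ <;> rcases hx with rfl | rfl <;>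
      simp at hs ht
  refine ⟨?_, ?_⟩
  · rintro (_ | x)
    · obtain ⟨t, htu, htv⟩ := h.big u v
      refine ConnOn.of_center (c := some t) (by simp) ?_
      rintro (_ | q) hq
      · simp at hq
      · by_cases hqu : q = u
        · subst hqu
          exact noedge v t q htv huv.ne (Or.inr rfl)
        · exact noedge u t q htu hqu (Or.inl rfl)
    · have hn : none ∈ ({some x}ᶜ : Set (Option V)) := by simp
      refine ConnOn.of_center (c := none) hn ?_
      rintro (_ | q) hq
      · exact ReachIn.refl _
      · have hq' : q ≠ x := by simpa using hq
        by_cases hxu : x = u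
        · subst hxu
          have hv : v ≠ x := huv.ne'
          exact (ReachIn.of_adj adj2 hn (by simpa using hv)).trans (lift x v q hv hq')
        · have hu : u ≠ x := fun h => hxu h.symm
          exact (ReachIn.of_adj adj1.symm hn (by simpa using hu)).trans (lift x u q hu hq')
  · rintro (_ | x) (_ | y)
    · exact ⟨some u, by simp⟩
    · obtain ⟨t, h1, _⟩ := h.big y y
      exact ⟨some t, by simp, by simpa using h1⟩
    · obtain ⟨t, h1, _⟩ := h.big x x
      exact ⟨some t, by simpa using h1, by simp⟩
    · exact ⟨none, by simp⟩

theorem IsSubdivision.twoConn {V W : Type} {G : SimpleGraph V} {H : SimpleGraph W}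
    (h : IsSubdivision G H) : TwoConn G → TwoConn H := by
  induction h with
  | of_iso e => exact fun h => h.of_iso e
  | step huv _ e ih => exact fun h => ((ih h).subdivideEdge huv).of_iso e

/-- The two Kuratowski graphs. -/
inductive IsKur : {n : ℕ} → SimpleGraph (Fin n) → Prop
  | five : IsKur K5
  | six : IsKur K33

namespace IsKur

variable {n : ℕ} {K : SimpleGraph (Fin n)}

theorem k33_adj_iff (i j : Fin 6) : K33.Adj i j ↔ (i.val < 3 ↔ 3 ≤ j.val) := by
  simp only [K33, SimpleGraph.fromRel_adj]
  constructor
  · rintro ⟨_, h | h⟩ <;> omega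
  · intro h
    refine ⟨?_, ?_⟩
    · rintro rfl; omega
    · omega

theorem threeConn (hK : IsKur K) (p q : Fin n) : ConnOn K {p, q}ᶜ := by
  cases hK with
  | five =>
    refine ⟨?_, ?_⟩
    · have key : ∀ p q : Fin 5, ∃ z : Fin 5, z ≠ p ∧ z ≠ q := by decide
      obtain ⟨z, hzp, hzq⟩ := key p q
      exact ⟨z, by simp [hzp, hzq]⟩
    · intro x hx y hy
      by_cases hxy : x = y
      · rw [hxy]; exact ReachIn.refl _
      · exact ReachIn.of_adj hxy hx hy
  | six =>
    have key : ∀ p q : Fin 6, (∃ z : Fin 6, z.val < 3 ∧ z ≠ p ∧ z ≠ q) ∧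
        (∃ z : Fin 6, 3 ≤ z.val ∧ z ≠ p ∧ z ≠ q) := by decide
    obtain ⟨⟨s, hs, hsp, hsq⟩, ⟨t, ht, htp, htq⟩⟩ := key p q
    have hs' : s ∈ ({p, q}ᶜ : Set (Fin 6)) := by simp [hsp, hsq]
    have ht' : t ∈ ({p, q}ᶜ : Set (Fin 6)) := by simp [htp, htq]
    refine ConnOn.of_center hs' fun x hx => ?_
    by_cases hx3 : x.val < 3
    · refine (ReachIn.of_adj (y := t) ?_ hs' ht').trans (ReachIn.of_adj ?_ ht' hx)
      · rw [k33_adj_iff]; omega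
      · rw [k33_adj_iff]; omega
    · refine ReachIn.of_adj ?_ hs' hx
      rw [k33_adj_iff]; omega

theorem big (hK : IsKur K) (p q : Fin n) : ∃ t, t ≠ p ∧ t ≠ q := by
  obtain ⟨t, ht⟩ := (hK.threeConn p q).1
  exact ⟨t, by simpa using ht⟩

theorem twoConn (hK : IsKur K) : TwoConn K :=
  ⟨fun x => by simpa using hK.threeConn x x, hK.big⟩

theorem exists_three_adj (hK : IsKur K) (i : Fin n) :
    ∃ x y z, x ≠ y ∧ x ≠ z ∧ y ≠ z ∧ K.Adj i x ∧ K.Adj i y ∧ K.Adj i z := by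
  cases hK with
  | five =>
    simp only [K5, SimpleGraph.top_adj]
    revert i; decide
  | six =>
    simp only [k33_adj_iff]
    revert i; decide

end IsKur

/-- `G` has a `K₅`-minor or a `K₃,₃`-minor whose branch sets lie in `S`. -/
def NonplanarOn {V : Type} (G : SimpleGraph V) (S : Set V) : Prop :=
  ∃ (n : ℕ) (K : SimpleGraph (Fin n)) (f : Fin n → Set V),
    IsKur K ∧ Model K G f ∧ ∀ w, f w ⊆ S

section Nonplanar

variable {V V' : Type} {G G' : SimpleGraph V} {S T : Set V}

theorem not_isPlanar_iff : ¬ IsPlanar G ↔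
    ∃ (n : ℕ) (K : SimpleGraph (Fin n)) (f : Fin n → Set V), IsKur K ∧ Model K G f := by
  rw [IsPlanar, isMinorOf_iff_model, isMinorOf_iff_model, not_and_or, not_not, not_not]
  constructor
  · rintro (⟨f, hf⟩ | ⟨f, hf⟩)
    · exact ⟨5, K5, f, IsKur.five, hf⟩
    · exact ⟨6, K33, f, IsKur.six, hf⟩
  · rintro ⟨n, K, f, hK, hf⟩
    cases hK with
    | five => exact Or.inl ⟨f, hf⟩
    | six => exact Or.inr ⟨f, hf⟩

theorem NonplanarOn.not_isPlanar {G' : SimpleGraph V'} (h : NonplanarOn G S) (φ : G' ↪g G)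
    (hS : S ⊆ Set.range φ) : ¬ IsPlanar G' := by
  obtain ⟨n, K, f, hK, hf, hfS⟩ := h
  exact not_isPlanar_iff.2 ⟨n, K, _, hK, hf.preimage φ fun w => (hfS w).trans hS⟩

theorem nonplanarOn_range {G' : SimpleGraph V'} (h : ¬ IsPlanar G') (φ : V' → V)
    (hinj : Function.Injective φ) (hφ : ∀ x y, G'.Adj x y → G.Adj (φ x) (φ y)) :
    NonplanarOn G (Set.range φ) := by
  obtain ⟨n, K, f, hK, hf⟩ := not_isPlanar_iff.1 h
  refine ⟨n, K, _, hK, hf.image φ (fun x y h => Or.inr (hφ x y h)) ?_, fun w =>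
    Set.image_subset_range _ _⟩
  intro w w' hne x hx y hy hxy
  rw [hinj hxy] at hx
  exact hne (hf.disj hx hy)

theorem NonplanarOn.mono (hG : G ≤ G') (hS : S ⊆ T) (h : NonplanarOn G S) :
    NonplanarOn G' T := by
  obtain ⟨n, K, f, hK, hf, hfS⟩ := h
  exact ⟨n, K, f, hK, ⟨fun w => (hf.conn w).mono_graph hG, hf.disj, fun w w' hww => by
    obtain ⟨x, hx, y, hy, hxy⟩ := hf.adj hww
    exact ⟨x, hx, y, hy, hG hxy⟩⟩, fun w => (hfS w).trans hS⟩

theorem nonplanarOn_induce (h : ¬ IsPlanar (G.induce S)) : NonplanarOn G S := by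
  have := nonplanarOn_range (G := G) h Subtype.val Subtype.val_injective fun x y h => h
  rwa [Subtype.range_coe] at this

theorem NonplanarOn.not_isPlanar_induce (h : NonplanarOn G S) : ¬ IsPlanar (G.induce S) :=
  h.not_isPlanar (SimpleGraph.Embedding.induce S) fun x hx => ⟨⟨x, hx⟩, rfl⟩

theorem Model.sdiff_of_separated {W : Type} {K : SimpleGraph W} {f : W → Set V}
    (hf : Model K G f) {X M : Set V} {a b : V} (hab : a ≠ b)
    (hXM : ∀ x ∈ X, ∀ y ∈ M, ¬ G.Adj x y) (ha : a ∉ M) (hb : b ∉ M)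
    (hsub : ∀ w, f w ⊆ X ∪ M ∪ {a, b}) (hno : ∀ w, ¬ f w ⊆ M) :
    Model K (G ⊔ SimpleGraph.edge a b) fun w => f w \ M := by
  classical
  have hle : G ≤ G ⊔ SimpleGraph.edge a b := le_sup_left
  have hadj : (G ⊔ SimpleGraph.edge a b).Adj a b := by simp [SimpleGraph.edge_adj, hab]
  have nbr : ∀ w, ∀ p ∈ M, ∀ q ∈ f w, q ∉ M → G.Adj p q → q = a ∨ q = b := by
    intro w p hp q hq hqM hpq
    rcases hsub w hq with (h | h) | h
    · exact absurd hpq.symm (hXM q h p hp)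
    · exact absurd h hqM
    · simpa using h
  have retract : ∀ w c, c ∈ f w → (c = a ∨ c = b) →
      ConnOn (G ⊔ SimpleGraph.edge a b) (f w \ M) := by
    intro w c hc hcab
    have hcM : c ∉ M := by rcases hcab with rfl | rfl <;> assumption
    have hout : ∀ p ∈ M, ∀ q ∈ f w, q ∉ M → G.Adj p q →
        c = q ∨ (G ⊔ SimpleGraph.edge a b).Adj c q := by
      intro p hp q hq hqM hpq
      rcases nbr w p hp q hq hqM hpq with rfl | rfl <;> rcases hcab with rfl | rfl
      · exact Or.inl rfl
      · exact Or.inr hadj.symm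
      · exact Or.inr hadj
      · exact Or.inl rfl
    have := (hf.conn w).image (G' := G ⊔ SimpleGraph.edge a b) (fun z => if z ∈ M then c else z) ?_
    · convert this using 1
      ext z
      simp only [Set.mem_sdiff, Set.mem_image]
      constructor
      · rintro ⟨hz, hzM⟩
        exact ⟨z, hz, by simp [hzM]⟩
      · rintro ⟨p, hp, rfl⟩
        by_cases hpM : p ∈ M
        · simp [hpM, hc, hcM]
        · simp [hpM, hp]
    · intro p hp q hq hpq
      by_cases hpM : p ∈ M <;> by_cases hqM : q ∈ M <;> simp only [hpM, hqM, if_true, if_false]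
      · exact Or.inl trivial
      · exact hout p hpM q hq hqM hpq
      · rcases hout q hqM p hp hpM hpq.symm with h | h
        · exact Or.inl h.symm
        · exact Or.inr h.symm
      · exact Or.inr (hle hpq)
  refine ⟨fun w => ?_, fun w w' x hx hx' => hf.disj hx.1 hx'.1, ?_⟩
  · by_cases haw : a ∈ f w
    · exact retract w a haw (Or.inl rfl)
    by_cases hbw : b ∈ f w
    · exact retract w b hbw (Or.inr rfl)
    obtain ⟨x, hx, hxM⟩ := Set.not_subset.1 (hno w)
    have hall : ∀ y ∈ f w, y ∉ M := by
      intro y hy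
      refine ((hf.conn w).2 x hx y hy).mem_of_closed (T := Mᶜ) hxM ?_
      intro p hp q hq hpw hpq hqM
      rcases nbr w q hqM p hpw hp hpq.symm with rfl | rfl
      · exact haw hpw
      · exact hbw hpw
    have : f w \ M = f w := by
      ext z
      exact ⟨fun h => h.1, fun h => ⟨h, hall z h⟩⟩
    rw [this]
    exact (hf.conn w).mono_graph hle
  · intro w w' hww
    obtain ⟨x, hx, y, hy, hxy⟩ := hf.adj hww
    have cross : ∀ w w', w ≠ w' → ∀ x ∈ f w, ∀ y ∈ f w', G.Adj x y → x ∈ M →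
        ∃ u ∈ f w \ M, ∃ v ∈ f w' \ M, (G ⊔ SimpleGraph.edge a b).Adj u v := by
      intro w w' hne x hx y hy hxy hxM
      have meet : ∀ w, ∀ x ∈ f w, x ∈ M → ∃ c ∈ f w, c = a ∨ c = b := by
        intro w x hx hxM
        by_contra! hcon
        refine hno w fun z hz => ((hf.conn w).2 x hx z hz).mem_of_closed hxM ?_
        intro p hp q hq _ hpq
        by_contra hqM
        rcases nbr w p hp q hq hqM hpq with h | h
        · exact (hcon q hq).1 h
        · exact (hcon q hq).2 h
      have h1 := meet w x hx hxM
      have h2 : ∃ c ∈ f w', c = a ∨ c = b := by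
        by_cases hyM : y ∈ M
        · exact meet w' y hy hyM
        · exact ⟨y, hy, nbr w' x hxM y hy hyM hxy⟩
      obtain ⟨c, hc, hc'⟩ := h1
      obtain ⟨d, hd, hd'⟩ := h2
      have hcd : c ≠ d := by
        rintro rfl
        exact hne (hf.disj hc hd)
      rcases hc' with rfl | rfl <;> rcases hd' with rfl | rfl
      · exact absurd rfl hcd
      · exact ⟨c, ⟨hc, ha⟩, d, ⟨hd, hb⟩, hadj⟩
      · exact ⟨c, ⟨hc, hb⟩, d, ⟨hd, ha⟩, hadj.symm⟩
      · exact absurd rfl hcd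
    by_cases hxM : x ∈ M
    · exact cross w w' hww.ne x hx y hy hxy hxM
    by_cases hyM : y ∈ M
    · obtain ⟨u, hu, v, hv, huv⟩ := cross w' w hww.ne' y hy x hx hxy.symm hyM
      exact ⟨v, hv, u, hu, huv.symm⟩
    exact ⟨x, ⟨hx, hxM⟩, y, ⟨hy, hyM⟩, hle hxy⟩

theorem NonplanarOn.two_sum (h : NonplanarOn G S) {X M : Set V} {a b : V} (hab : a ≠ b)
    (hXM : ∀ x ∈ X, ∀ y ∈ M, ¬ G.Adj x y) (haX : a ∉ X) (hbX : b ∉ X) (haM : a ∉ M)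
    (hbM : b ∉ M) (hdis : Disjoint X M) (hsub : S ⊆ X ∪ M ∪ {a, b}) :
    NonplanarOn (G ⊔ SimpleGraph.edge a b) (X ∪ {a, b}) ∨
      NonplanarOn (G ⊔ SimpleGraph.edge a b) (M ∪ {a, b}) := by
  obtain ⟨n, K, f, hK, hf, hfS⟩ := h
  have hsub' : ∀ w, f w ⊆ X ∪ M ∪ {a, b} := fun w => (hfS w).trans hsub
  by_cases hM : ∃ w, f w ⊆ M
  swap
  · left
    push Not at hM
    refine ⟨n, K, _, hK, hf.sdiff_of_separated hab hXM haM hbM hsub' hM, ?_⟩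
    rintro w x ⟨hx, hxM⟩
    rcases hsub' w hx with (h | h) | h
    · exact Or.inl h
    · exact absurd h hxM
    · exact Or.inr h
  by_cases hX : ∃ w, f w ⊆ X
  swap
  · right
    push Not at hX
    refine ⟨n, K, _, hK, hf.sdiff_of_separated (X := M) (M := X) hab
      (fun x hx y hy hxy => hXM y hy x hx hxy.symm) haX hbX
      (by rwa [Set.union_comm M X]) hX, ?_⟩
    rintro w x ⟨hx, hxM⟩
    rcases hsub' w hx with (h | h) | h
    · exact absurd h hxM
    · exact Or.inl h
    · exact Or.inr h
  exfalso
  obtain ⟨w, hw⟩ := hM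
  obtain ⟨w', hw'⟩ := hX
  obtain ⟨t, htw, htw'⟩ := hK.big w w'
  have owner : ∀ c : V, c ∉ X → c ∉ M → ∃ p, p ≠ w ∧ p ≠ w' ∧ ∀ i, c ∈ f i → i = p := by
    intro c hcX hcM
    by_cases hc : ∃ p, c ∈ f p
    · obtain ⟨p, hp⟩ := hc
      refine ⟨p, ?_, ?_, fun i hi => hf.disj hi hp⟩
      · rintro rfl; exact hcM (hw hp)
      · rintro rfl; exact hcX (hw' hp)
    · exact ⟨t, htw, htw', fun i hi => absurd ⟨i, hi⟩ hc⟩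
  obtain ⟨p, hpw, hpw', hp⟩ := owner a haX haM
  obtain ⟨q, hqw, hqw', hq⟩ := owner b hbX hbM
  have hreach := (hK.threeConn p q).2 w (by simp [hpw.symm, hqw.symm]) w'
    (by simp [hpw'.symm, hqw'.symm])
  have : f w' ⊆ M := by
    refine hreach.mem_of_closed (T := {i | f i ⊆ M}) hw ?_
    intro i hi j hj _ hij
    simp only [Set.mem_compl_iff, Set.mem_insert_iff, Set.mem_singleton_iff, not_or] at hj
    have hjXM : ∀ z ∈ f j, z ∉ M → z ∈ X := by
      intro z hz hzM
      rcases hsub' j hz with (h | h) | h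
      · exact h
      · exact absurd h hzM
      · rcases h with rfl | rfl
        · exact absurd (hp j hz) hj.1
        · exact absurd (hq j hz) hj.2
    obtain ⟨x, hx, y, hy, hxy⟩ := hf.adj hij
    have hyM : y ∈ M := by
      by_contra hyM
      exact hXM y (hjXM y hy hyM) x (hi hx) hxy.symm
    intro z hz
    refine ((hf.conn j).2 y hy z hz).mem_of_closed hyM ?_
    intro r hr s hs _ hrs
    by_contra hsM
    exact hXM s (hjXM s hs hsM) r hr hrs.symm
  obtain ⟨z, hz⟩ := (hf.conn w').1
  exact Set.disjoint_left.1 hdis (hw' hz) (this hz)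

/-- If `v` has at most one neighbour other than `w`, the model can be chosen with `v` and `w`
not in different branch sets. -/
theorem Model.exists_not_split {n : ℕ} {K : SimpleGraph (Fin n)} (hK : IsKur K)
    {f : Fin n → Set V} (hf : Model K G f) {v w u : V} (hvw : G.Adj v w)
    (hdeg : ∀ x, G.Adj v x → x = w ∨ x = u) (hfS : ∀ i, f i ⊆ S) :
    ∃ f', Model K G f' ∧ (∀ i j, v ∈ f' i → w ∈ f' j → i = j) ∧ ∀ i, f' i ⊆ S := by
  classical
  by_cases hsplit : ∀ i j, v ∈ f i → w ∈ f j → i = j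
  · exact ⟨f, hf, hsplit, hfS⟩
  push Not at hsplit
  obtain ⟨i, j, hvi, hwj, hij⟩ := hsplit
  have hwi : w ∉ f i := fun h => hij (hf.disj h hwj)
  have hvj : v ∉ f j := fun h => hij (hf.disj hvi h)
  have hne : ∃ t ∈ f i, t ≠ v := by
    by_contra! hcon
    obtain ⟨x, y, z, hxy, hxz, hyz, hx, hy, hz⟩ := hK.exists_three_adj i
    have get : ∀ k, K.Adj i k → w ∈ f k ∨ u ∈ f k := by
      intro k hk
      obtain ⟨p, hp, q, hq, hpq⟩ := hf.adj hk
      rw [hcon p hp] at hpq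
      rcases hdeg q hpq with rfl | rfl
      · exact Or.inl hq
      · exact Or.inr hq
    rcases get x hx with h1 | h1 <;> rcases get y hy with h2 | h2 <;>
      rcases get z hz with h3 | h3 <;>
      first
        | exact hxy (hf.disj h1 h2)
        | exact hxz (hf.disj h1 h3)
        | exact hyz (hf.disj h2 h3)
  obtain ⟨t, ht, htv⟩ := hne
  have hu : u ∈ f i ∧ G.Adj v u := by
    rcases Relation.ReflTransGen.cases_head ((hf.conn i).2 v hvi t ht) with h | ⟨c, hc, _⟩
    · exact absurd h.symm htv
    · rcases hdeg c hc.1 with rfl | rfl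
      · exact absurd hc.2.2 hwi
      · exact ⟨hc.2.2, hc.1⟩
  have hconn : ∀ k, ConnOn G {x | (x ≠ v ∧ x ∈ f k) ∨ (x = v ∧ k = j)} := by
    intro k
    by_cases hki : k = i
    · subst hki
      have := (hf.conn k).image (G' := G) (fun z => if z = v then u else z) ?_
      · convert this using 1
        ext z
        simp only [Set.mem_ofPred_eq, Set.mem_image, hij, and_false, or_false]
        constructor
        · rintro ⟨hz, hzk⟩
          exact ⟨z, hzk, by simp [hz]⟩
        · rintro ⟨p, hp, rfl⟩
          by_cases hpv : p = v
          · simp [hpv, hu.1, hu.2.ne']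
          · simp [hpv, hp]
      · have one : ∀ q ∈ f k, G.Adj v q → u = q := by
          intro q hq hvq
          rcases hdeg q hvq with rfl | rfl
          · exact absurd hq hwi
          · rfl
        intro p hp q hq hpq
        by_cases hpv : p = v <;> by_cases hqv : q = v <;> simp only [hpv, hqv, if_true, if_false]
        · exact Or.inl trivial
        · exact Or.inl (one q hq (hpv ▸ hpq))
        · exact Or.inl (one p hp (hqv ▸ hpq.symm)).symm
        · exact Or.inr hpq
    · have hvk : v ∉ f k := fun h => hki (hf.disj h hvi)
      have hsub : f k ⊆ {x | (x ≠ v ∧ x ∈ f k) ∨ (x = v ∧ k = j)} := fun x hx =>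
        Or.inl ⟨fun h => hvk (h ▸ hx), hx⟩
      by_cases hkj : k = j
      · subst hkj
        refine ConnOn.of_center (hsub hwj) ?_
        rintro x (⟨_, hx⟩ | ⟨rfl, _⟩)
        · exact ((hf.conn k).2 w hwj x hx).mono (fun _ _ _ _ h => h) hsub
        · exact ReachIn.of_adj hvw.symm (hsub hwj) (Or.inr ⟨rfl, rfl⟩)
      · convert hf.conn k using 1
        ext x
        constructor
        · rintro (⟨_, hx⟩ | ⟨_, hx⟩)
          · exact hx
          · exact absurd hx hkj
        · exact fun hx => hsub hx
  refine ⟨fun k => {x | (x ≠ v ∧ x ∈ f k) ∨ (x = v ∧ k = j)}, ⟨hconn, ?_, ?_⟩, ?_, ?_⟩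
  · rintro k l x (⟨h1, h2⟩ | ⟨h1, h2⟩) (⟨h3, h4⟩ | ⟨h3, h4⟩)
    · exact hf.disj h2 h4
    · exact absurd h3 h1
    · exact absurd h1 h3
    · rw [h2, h4]
  · have half : ∀ k l, K.Adj k l → ∀ y ∈ f l, v ∈ f k → G.Adj v y → k = i ∧ l = j := by
      intro k l hkl y hy hvk hvy
      have hki : k = i := hf.disj hvk hvi
      refine ⟨hki, ?_⟩
      rcases hdeg y hvy with rfl | rfl
      · exact hf.disj hy hwj
      · exact absurd ((hf.disj hu.1 hy).symm.trans hki.symm) hkl.ne'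
    intro k l hkl
    obtain ⟨x, hx, y, hy, hxy⟩ := hf.adj hkl
    by_cases hxv : x = v
    · subst hxv
      obtain ⟨rfl, rfl⟩ := half k l hkl y hy hx hxy
      exact ⟨u, Or.inl ⟨hu.2.ne', hu.1⟩, x, Or.inr ⟨rfl, rfl⟩, hu.2.symm⟩
    by_cases hyv : y = v
    · subst hyv
      obtain ⟨rfl, rfl⟩ := half l k hkl.symm x hx hy hxy.symm
      exact ⟨y, Or.inr ⟨rfl, rfl⟩, u, Or.inl ⟨hu.2.ne', hu.1⟩, hu.2⟩
    exact ⟨x, Or.inl ⟨hxv, hx⟩, y, Or.inl ⟨hyv, hy⟩, hxy⟩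
  · rintro k l (⟨h, _⟩ | ⟨_, rfl⟩) (⟨_, h'⟩ | ⟨h', _⟩)
    · exact absurd rfl h
    · exact absurd rfl h
    · exact hf.disj hwj h'
    · exact absurd h' hvw.ne'
  · rintro k x (⟨_, hx⟩ | ⟨rfl, _⟩)
    · exact hfS k hx
    · exact hfS i hvi

theorem contractEdge_mono {H : SimpleGraph V} (hle : H ≤ G) (u v : V) :
    contractEdge H u v ≤ contractEdge G u v := by
  intro x y hxy
  simp only [contractEdge, SimpleGraph.fromRel_adj] at hxy ⊢
  refine ⟨hxy.1, hxy.2.imp ?_ ?_⟩ <;>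
    exact fun h => ⟨h.1, h.2.1, h.2.2.imp (@hle _ _)
      (Or.imp (And.imp_right (@hle _ _)) (And.imp_right (@hle _ _)))⟩

theorem contractEdge_adj_of_ne {u v x y : V} (hx : x ≠ v) (hy : y ≠ v) (h : G.Adj x y) :
    (contractEdge G u v).Adj x y := by
  simp only [contractEdge, SimpleGraph.fromRel_adj]
  exact ⟨h.ne, Or.inl ⟨hx, hy, Or.inl h⟩⟩

open Classical in
/-- The vertex map of the contraction of `v` into `w`. -/
noncomputable def collapse (w v : V) : V → V := fun x => if x = v then w else x

theorem collapse_self (w v : V) : collapse w v v = w := by simp [collapse]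

theorem collapse_of_ne {w v x : V} (h : x ≠ v) : collapse w v x = x := by simp [collapse, h]

theorem collapse_adj {w v : V} (hwv : w ≠ v) {x y : V} (h : G.Adj x y) :
    collapse w v x = collapse w v y ∨
      (contractEdge G w v).Adj (collapse w v x) (collapse w v y) := by
  by_cases hx : x = v
  · subst hx
    have hy : y ≠ x := h.ne'
    rw [collapse_self, collapse_of_ne hy]
    by_cases hyw : w = y
    · exact Or.inl hyw
    · right
      simp only [contractEdge, SimpleGraph.fromRel_adj]
      exact ⟨hyw, Or.inl ⟨hwv, hy, Or.inr (Or.inl ⟨trivial, h⟩)⟩⟩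
  by_cases hy : y = v
  · subst hy
    rw [collapse_self, collapse_of_ne hx]
    by_cases hxw : x = w
    · exact Or.inl hxw
    · right
      simp only [contractEdge, SimpleGraph.fromRel_adj]
      exact ⟨hxw, Or.inl ⟨hx, hwv, Or.inr (Or.inr ⟨trivial, h⟩)⟩⟩
  rw [collapse_of_ne hx, collapse_of_ne hy]
  exact Or.inr (contractEdge_adj_of_ne hx hy h)

theorem Model.contractEdge {W : Type} {K : SimpleGraph W} {f : W → Set V} (hf : Model K G f)
    {v w : V} (hwv : w ≠ v) (hsplit : ∀ i j, v ∈ f i → w ∈ f j → i = j) :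
    Model K (contractEdge G w v) fun i => collapse w v '' f i := by
  refine hf.image _ (fun x y h => collapse_adj hwv h) ?_
  intro i j hij x hx y hy h
  by_cases hxv : x = v
  · subst hxv
    by_cases hyv : y = x
    · subst hyv
      exact hij (hf.disj hx hy)
    · rw [collapse_self, collapse_of_ne hyv] at h
      subst h
      exact hij (hsplit i j hx hy)
  · by_cases hyv : y = v
    · subst hyv
      rw [collapse_self, collapse_of_ne hxv] at h
      subst h
      exact hij (hsplit j i hy hx).symm
    · rw [collapse_of_ne hxv, collapse_of_ne hyv] at h
      subst h
      exact hij (hf.disj hx hy)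

end Nonplanar

/-- The properties of a subdivision `H` of a Kuratowski graph, with vertex set `S`, that are
needed below. -/
structure KuratowskiOn {V : Type} (H : SimpleGraph V) (S : Set V) : Prop where
  nonplanar : NonplanarOn H S
  conn : ∀ y, ConnOn H (S \ {y})
  big : ∀ x y, ∃ t ∈ S, t ≠ x ∧ t ≠ y
  supp : ∀ ⦃x y⦄, H.Adj x y → x ∈ S

theorem IsKuratowski.kuratowskiOn {V : Type} {G : SimpleGraph V} {H : G.Subgraph}
    (h : IsKuratowski H) : KuratowskiOn H.spanningCoe H.verts := by
  obtain ⟨n, K, hK, hs⟩ : ∃ (n : ℕ) (K : SimpleGraph (Fin n)), IsKur K ∧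
      IsSubdivision K H.coe := by
    rcases h with h | h
    · exact ⟨5, K5, IsKur.five, h⟩
    · exact ⟨6, K33, IsKur.six, h⟩
  have htc : TwoConn H.coe := hs.twoConn hK.twoConn
  have big : ∀ x y, ∃ t ∈ H.verts, t ≠ x ∧ t ≠ y := by
    have one : ∀ x : V, ∃ p : H.verts, x ∈ H.verts → (p : V) = x := by
      obtain ⟨⟨p⟩⟩ : Nonempty (Nonempty H.verts) := by
        obtain ⟨f, hf⟩ := isMinorOf_iff_model.1 hs.isMinorOf
        have hn : Nonempty (Fin n) := by cases hK <;> exact ⟨0⟩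
        obtain ⟨i⟩ := hn
        obtain ⟨x, _⟩ := (hf.conn i).1
        exact ⟨⟨x⟩⟩
      intro x
      by_cases hx : x ∈ H.verts
      · exact ⟨⟨x, hx⟩, fun _ => rfl⟩
      · exact ⟨p, fun h => absurd h hx⟩
    intro x y
    obtain ⟨p, hp⟩ := one x
    obtain ⟨q, hq⟩ := one y
    obtain ⟨t, htp, htq⟩ := htc.big p q
    refine ⟨t, t.2, ?_, ?_⟩
    · rintro rfl; exact htp (Subtype.ext (hp t.2).symm)
    · rintro rfl; exact htq (Subtype.ext (hq t.2).symm)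
  have conn : ∀ y ∈ H.verts, ConnOn H.spanningCoe (H.verts \ {y}) := by
    intro y hy
    have := (htc.conn ⟨y, hy⟩).image (G' := H.spanningCoe) Subtype.val
      fun p _ q _ hpq => Or.inr hpq
    convert this using 1
    ext z
    simp only [Set.mem_sdiff, Set.mem_singleton_iff, Set.mem_image, Set.mem_compl_iff]
    constructor
    · rintro ⟨hz, hzy⟩
      exact ⟨⟨z, hz⟩, fun h => hzy (congrArg Subtype.val h), rfl⟩
    · rintro ⟨p, hp, rfl⟩
      exact ⟨p.2, fun h => hp (Subtype.ext h)⟩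
  refine ⟨?_, fun y => ?_, big, fun x y h => h.fst_mem⟩
  · obtain ⟨f, hf⟩ := isMinorOf_iff_model.1 hs.isMinorOf
    have := nonplanarOn_range (G := H.spanningCoe) (not_isPlanar_iff.2 ⟨n, K, f, hK, hf⟩)
      Subtype.val Subtype.val_injective fun x y h => h
    rwa [Subtype.range_coe] at this
  · by_cases hy : y ∈ H.verts
    · exact conn y hy
    · have hS : H.verts \ {y} = H.verts := Set.sdiff_singleton_eq_self hy
      rw [hS]
      obtain ⟨t, ht, _⟩ := big y y
      refine ⟨⟨t, ht⟩, fun p hp q hq => ?_⟩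
      obtain ⟨s, hs, hsp, hsq⟩ := big p q
      exact ((conn s hs).2 p ⟨hp, hsp.symm⟩ q ⟨hq, hsq.symm⟩).mono (fun _ _ _ _ h => h)
        Set.sdiff_subset

/-- Deleting a vertex and an adjacent vertex of degree at most two keeps the graph connected. -/
theorem ConnOn.sdiff_leaf {V : Type} {H : SimpleGraph V} {S : Set V} (h : ConnOn H S) {v u : V}
    (hne : ∃ t ∈ S, t ≠ v) (hv : ∀ x ∈ S, H.Adj v x → x = u) : ConnOn H (S \ {v}) := by
  classical
  by_cases hvS : v ∈ S
  swap
  · rwa [Set.sdiff_singleton_eq_self hvS]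
  obtain ⟨t, ht, htv⟩ := hne
  have hu : u ∈ S ∧ H.Adj v u := by
    rcases Relation.ReflTransGen.cases_head (h.2 v hvS t ht) with h | ⟨c, hc, _⟩
    · exact absurd h.symm htv
    · obtain rfl := hv c hc.2.2 hc.1
      exact ⟨hc.2.2, hc.1⟩
  have := h.image (G' := H) (fun z => if z = v then u else z) ?_
  · convert this using 1
    ext z
    simp only [Set.mem_sdiff, Set.mem_singleton_iff, Set.mem_image]
    constructor
    · rintro ⟨hz, hzk⟩
      exact ⟨z, hz, by simp [hzk]⟩
    · rintro ⟨p, hp, rfl⟩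
      by_cases hpv : p = v
      · simp [hpv, hu.1, hu.2.ne']
      · simp [hpv, hp]
  · intro p hp q hq hpq
    by_cases hpv : p = v <;> by_cases hqv : q = v <;> simp only [hpv, hqv, if_true, if_false]
    · exact Or.inl trivial
    · exact Or.inl (hv q hq (hpv ▸ hpq)).symm
    · exact Or.inl (hv p hp (hqv ▸ hpq.symm))
    · exact Or.inr hpq

theorem connOn_reachable {V : Type} (G : SimpleGraph V) (S : Set V) (a : V) :
    ConnOn G {x | ReachIn G S a x} := by
  refine ConnOn.of_center (c := a) (ReachIn.refl a) fun x hx => ?_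
  have hx : ReachIn G S a x := hx
  induction hx with
  | refl => exact ReachIn.refl _
  | @tail p q hp hpq ih =>
    exact (ih hp).trans
      (ReachIn.of_adj hpq.1 hp (ReachIn.trans hp (ReachIn.of_adj hpq.1 hpq.2.1 hpq.2.2)))

section Obstruction

variable {V : Type} {G : SimpleGraph V}

theorem IsApex.exists_vertex (h : IsApex G) (x : V) : ∃ y, ¬ NonplanarOn G {y}ᶜ := by
  rcases h with h | ⟨y, h⟩
  · refine ⟨x, fun hx => ?_⟩
    refine hx.not_isPlanar (SimpleGraph.Embedding.refl (G := G)) ?_ h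
    intro z _
    exact ⟨z, rfl⟩
  · exact ⟨y, fun hy => hy.not_isPlanar_induce h⟩

theorem IsApex.exists_vertex_induce {S : Set V} (h : IsApex (G.induce S)) {x : V} (hx : x ∈ S) :
    ∃ y ∈ S, ¬ NonplanarOn G (S \ {y}) := by
  rcases h with h | ⟨y, h⟩
  · exact ⟨x, hx, fun hn => (hn.mono le_rfl Set.sdiff_subset).not_isPlanar_induce h⟩
  · refine ⟨y, y.2, fun hn => ?_⟩
    refine hn.not_isPlanar ((SimpleGraph.Embedding.induce {u | u ≠ y}).trans
      (SimpleGraph.Embedding.induce S)) ?_ h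
    rintro z ⟨hz, hzy⟩
    exact ⟨⟨⟨z, hz⟩, fun h => hzy (congrArg Subtype.val h)⟩, rfl⟩

theorem IsApexObstruction.nonplanarOn_compl (h : IsApexObstruction G) (y : V) :
    NonplanarOn G {y}ᶜ :=
  nonplanarOn_induce fun hp => h.1 (Or.inr ⟨y, hp⟩)

variable [Finite V]

theorem IsApexObstruction.isApex_induce (h : IsApexObstruction G) {G' : SimpleGraph V}
    {S : Set V} {x : V} (hx : x ∉ S) (hm : (G'.induce S).IsMinorOf G) :
    IsApex (G'.induce S) := by
  refine h.2 _ _ hm ⟨fun e => hx ?_⟩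
  have h1 : S.ncard = Nat.card V := Nat.card_congr e.toEquiv
  have h2 : S = Set.univ := (Set.eq_univ_iff_ncard S).2 h1
  rw [h2]
  trivial

theorem IsApexObstruction.isApex_deleteEdges (h : IsApexObstruction G) {p q : V}
    (hpq : G.Adj p q) : IsApex (G.deleteEdges {s(p, q)}) := by
  refine h.2 _ _ (isMinorOf_of_hom id Function.injective_id fun x y h =>
    (SimpleGraph.deleteEdges_le _) h) ⟨fun e => ?_⟩
  have h1 : (G.deleteEdges {s(p, q)}).edgeSet.ncard = G.edgeSet.ncard :=
    Nat.card_congr e.mapEdgeSet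
  have h2 : (G.deleteEdges {s(p, q)}).edgeSet ⊂ G.edgeSet := by
    rw [SimpleGraph.edgeSet_deleteEdges]
    refine ⟨Set.sdiff_subset, fun hsub => ?_⟩
    exact (hsub (show s(p, q) ∈ G.edgeSet from hpq)).2 rfl
  exact absurd h1 (Set.ncard_lt_ncard h2 (Set.toFinite _)).ne

theorem IsApexObstruction.isApex_contractEdge (h : IsApexObstruction G) {v w : V}
    (hvw : G.Adj v w) : IsApex ((contractEdge G w v).induce {v}ᶜ) := by
  refine h.isApex_induce (x := v) (by simp) ?_
  rw [isMinorOf_iff_model]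
  refine ⟨fun x => {z | z = x ∨ (z = v ∧ (x : V) = w)}, ?_, ?_, ?_⟩
  · rintro ⟨x, hx⟩
    refine ConnOn.of_center (c := x) (Or.inl rfl) ?_
    rintro z (rfl | ⟨rfl, rfl⟩)
    · exact ReachIn.refl _
    · exact ReachIn.of_adj hvw.symm (Or.inl rfl) (Or.inr ⟨rfl, rfl⟩)
  · rintro ⟨x, hx⟩ ⟨y, hy⟩ z (hz | ⟨hz, hzw⟩) (hz' | ⟨hz', hzw'⟩)
    · exact Subtype.ext (hz.symm.trans hz')
    · exact absurd (hz.symm.trans hz') hx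
    · exact absurd (hz'.symm.trans hz) hy
    · exact Subtype.ext (hzw.trans hzw'.symm)
  · rintro ⟨x, hx⟩ ⟨y, hy⟩ hxy
    have hxy : (contractEdge G w v).Adj x y := hxy
    simp only [contractEdge, SimpleGraph.fromRel_adj] at hxy
    rcases hxy.2 with ⟨_, _, h | ⟨h1, h2⟩ | ⟨h1, h2⟩⟩ | ⟨_, _, h | ⟨h1, h2⟩ | ⟨h1, h2⟩⟩
    · exact ⟨x, Or.inl rfl, y, Or.inl rfl, h⟩
    · exact ⟨v, Or.inr ⟨rfl, h1⟩, y, Or.inl rfl, h2⟩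
    · exact ⟨x, Or.inl rfl, v, Or.inr ⟨rfl, h1⟩, h2⟩
    · exact ⟨x, Or.inl rfl, y, Or.inl rfl, h.symm⟩
    · exact ⟨x, Or.inl rfl, v, Or.inr ⟨rfl, h1⟩, h2.symm⟩
    · exact ⟨v, Or.inr ⟨rfl, h1⟩, y, Or.inl rfl, h2.symm⟩

/-- Two Kuratowski subgraphs of a connected obstruction meet. -/
theorem IsApexObstruction.exists_mem_inter (h : IsApexObstruction G)
    (hconn : ConnOn G Set.univ) {H₁ H₂ : SimpleGraph V} {S₁ S₂ : Set V} (h₁ : H₁ ≤ G)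
    (h₂ : H₂ ≤ G) (hK₁ : KuratowskiOn H₁ S₁) (hK₂ : KuratowskiOn H₂ S₂) :
    ∃ x ∈ S₁, x ∈ S₂ := by
  by_contra! hdis
  obtain ⟨s, hs, _⟩ := hK₁.big hconn.1.some hconn.1.some
  obtain ⟨t, ht, _⟩ := hK₂.big s s
  obtain ⟨p, hp, q, hq, hpq⟩ : ∃ p ∈ S₁, ∃ q, q ∉ S₁ ∧ G.Adj p q := by
    by_contra! hcon
    refine hdis t ?_ ht
    refine (hconn.2 s trivial t trivial).mem_of_closed hs fun p hp q _ _ hpq => ?_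
    by_contra hq
    exact hcon p hp q hq hpq
  obtain ⟨y, hy⟩ := (h.isApex_deleteEdges hpq).exists_vertex p
  have l₁ : H₁ ≤ G.deleteEdges {s(p, q)} := by
    intro x z hxz
    rw [SimpleGraph.deleteEdges_adj]
    refine ⟨h₁ hxz, fun he => hq ?_⟩
    rcases Sym2.eq_iff.1 he with ⟨rfl, rfl⟩ | ⟨rfl, rfl⟩
    · exact hK₁.supp hxz.symm
    · exact hK₁.supp hxz
  have l₂ : H₂ ≤ G.deleteEdges {s(p, q)} := by
    intro x z hxz
    rw [SimpleGraph.deleteEdges_adj]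
    refine ⟨h₂ hxz, fun he => hdis p hp ?_⟩
    rcases Sym2.eq_iff.1 he with ⟨rfl, rfl⟩ | ⟨rfl, rfl⟩
    · exact hK₂.supp hxz
    · exact hK₂.supp hxz.symm
  have m₁ : y ∈ S₁ := by
    by_contra hyS
    exact hy (hK₁.nonplanar.mono l₁ fun x hx hxy => hyS (hxy ▸ hx))
  have m₂ : y ∈ S₂ := by
    by_contra hyS
    exact hy (hK₂.nonplanar.mono l₂ fun x hx hxy => hyS (hxy ▸ hx))
  exact hdis y m₁ m₂

end Obstruction

section Cut

variable {V : Type} {G : SimpleGraph V} {a b : V} {C : Set V}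

/-- A path from `a` to `b` through `C` can replace a virtual edge `ab` on the other side. -/
theorem NonplanarOn.of_virtual_edge (h : NonplanarOn (G ⊔ SimpleGraph.edge a b) Cᶜ) (hab : a ≠ b)
    (hb : b ∉ C) {G' : SimpleGraph V}
    (hG' : ∀ x, x ∉ C → ∀ y, y ∉ C → G.Adj x y → G'.Adj x y) {T : Set V} (hT : T ⊆ C ∪ {a, b})
    (hr : ReachIn G' T a b) : NonplanarOn G' (T ∪ Cᶜ) := by
  classical
  obtain ⟨n, K, f, hK, hf, hfC⟩ := h
  have memP : ∀ x, ReachIn G' (T \ {b}) a x → x = a ∨ (x ∈ T ∧ x ≠ b) := by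
    intro x hx
    cases hx with
    | refl => exact Or.inl rfl
    | tail _ h => exact Or.inr h.2.2
  have hedge : ∃ p, ReachIn G' (T \ {b}) a p ∧ G'.Adj p b := by
    have key : ∀ z, ReachIn G' T a z → ReachIn G' (T \ {b}) a z ∨
        ∃ p, ReachIn G' (T \ {b}) a p ∧ G'.Adj p b := by
      intro z hz
      induction hz with
      | refl => exact Or.inl (ReachIn.refl _)
      | @tail p q _ hpq ih =>
        rcases ih with ih | ih
        swap
        · exact Or.inr ih
        by_cases hq : q = b
        · exact Or.inr ⟨p, ih, hq ▸ hpq.1⟩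
        have hp : p ≠ b := by
          rcases memP p ih with h | h
          · rw [h]; exact hab
          · exact h.2
        exact Or.inl (ih.trans (ReachIn.of_adj hpq.1 ⟨hpq.2.1, hp⟩ ⟨hpq.2.2, hq⟩))
    rcases key b hr with h | h
    · rcases memP b h with h | h
      · exact absurd h.symm hab
      · exact absurd rfl h.2
    · exact h
  obtain ⟨p, hp, hpb⟩ := hedge
  have memP' : ∀ x, ReachIn G' (T \ {b}) a x → x ∉ C → x = a := by
    intro x hx hxC
    rcases memP x hx with h | ⟨h1, h2⟩
    · exact h
    · rcases hT h1 with h | h | h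
      · exact absurd h hxC
      · exact h
      · exact absurd h h2
  let g : V → Set V := fun x => if x = a then {z | ReachIn G' (T \ {b}) a z} else {x}
  have ga : g a = {z | ReachIn G' (T \ {b}) a z} := by simp [g]
  have gne : ∀ x, x ≠ a → g x = {x} := fun x hx => by simp [g, hx]
  have self : ∀ x, x ∈ g x := by
    intro x
    by_cases hx : x = a
    · subst hx; rw [ga]; exact ReachIn.refl _
    · rw [gne x hx]; rfl
  refine ⟨n, K, _, hK, hf.bind g hfC ?_ ?_ ?_, ?_⟩
  · intro x _
    by_cases hx : x = a
    · subst hx; rw [ga]; exact connOn_reachable _ _ _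
    · rw [gne x hx]; exact ConnOn.singleton _ _
  · intro x hx y hy z hzx hzy
    by_cases hxa : x = a <;> by_cases hya : y = a
    · rw [hxa, hya]
    · rw [hxa, ga] at hzx
      rw [gne y hya] at hzy
      obtain rfl := hzy
      exact absurd (memP' z hzx hy) hya
    · rw [hya, ga] at hzy
      rw [gne x hxa] at hzx
      obtain rfl := hzx
      exact absurd (memP' z hzy hx) hxa
    · rw [gne x hxa] at hzx
      rw [gne y hya] at hzy
      exact hzx.symm.trans hzy
  · intro x hx y hy hxy
    rcases hxy with hxy | hxy
    · exact ⟨x, self x, y, self y, hG' x hx y hy hxy⟩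
    · rw [SimpleGraph.edge_adj] at hxy
      rcases hxy.1 with ⟨rfl, rfl⟩ | ⟨rfl, rfl⟩
      · exact ⟨p, by rw [ga]; exact hp, y, self y, hpb⟩
      · exact ⟨x, self x, p, by rw [ga]; exact hp, hpb.symm⟩
  · intro w z hz
    simp only [Set.mem_iUnion] at hz
    obtain ⟨x, hx, hz⟩ := hz
    by_cases hxa : x = a
    · rw [hxa, ga] at hz
      rcases memP z hz with rfl | h
      · exact Or.inr (hxa ▸ hfC w hx)
      · exact Or.inl h.1
    · rw [gne x hxa] at hz
      obtain rfl := hz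
      exact Or.inr (hfC w hx)

theorem ReachIn.through_component (hC : IsCompOf G {a, b} C)
    (huniq : ∀ T : Set V, IsTwoCut G T → T = ({a, b} : Set V)) {x y : V} (hx : x ∈ C) (hy : y ∈ C)
    (hxy : x ≠ y) (hab : a ≠ b) : ReachIn G ((C ∪ {a}) \ {y}) x a := by
  have haC : a ∉ C := fun h => Set.disjoint_left.1 hC.2.1 h (by simp)
  have hbC : b ∉ C := fun h => Set.disjoint_left.1 hC.2.1 h (by simp)
  have hyb : y ≠ b := fun h => hbC (h ▸ hy)
  have hya : y ≠ a := fun h => haC (h ▸ hy)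
  have hxb : x ≠ b := fun h => hbC (h ▸ hx)
  have hpre : (G.induce ({y, b} : Set V)ᶜ).Preconnected := by
    by_contra hcon
    have h1 := huniq {y, b} ⟨Set.ncard_pair hyb, hcon⟩
    have h2 : y ∈ ({a, b} : Set V) := by rw [← h1]; simp
    rcases h2 with h | h
    · exact hya h
    · exact hyb h
  have hr := preconnected_induce_iff_reachIn.1 hpre x (by simp [hxy, hxb]) a
    (by simp [hya.symm, hab])
  have key : ∀ z, ReachIn G ({y, b} : Set V)ᶜ x z →
      (z ∈ C ∧ ReachIn G ((C ∪ {a}) \ {y}) x z) ∨ ReachIn G ((C ∪ {a}) \ {y}) x a := by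
    intro z hz
    induction hz with
    | refl => exact Or.inl ⟨hx, ReachIn.refl _⟩
    | @tail p q _ hpq ih =>
      rcases ih with ⟨hpC, ih⟩ | ih
      swap
      · exact Or.inr ih
      obtain ⟨hadj, hp, hq⟩ := hpq
      simp only [Set.mem_compl_iff, Set.mem_insert_iff, Set.mem_singleton_iff, not_or] at hp hq
      by_cases hqa : q = a
      · subst hqa
        exact Or.inr (ih.trans (ReachIn.of_adj hadj ⟨Or.inl hpC, hp.1⟩ ⟨Or.inr rfl, hq.1⟩))
      · have hqC : q ∈ C := hC.2.2.2 p hpC q (by simp [hqa, hq.2]) hadj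
        exact Or.inl ⟨hqC, ih.trans
          (ReachIn.of_adj hadj ⟨Or.inl hpC, hp.1⟩ ⟨Or.inl hqC, hq.1⟩)⟩
  rcases key a hr with h | h
  · exact h.2
  · exact h

theorem IsCompOf.exists_adj {L : Set V} (hL : IsCompOf G {a, b} L) (hconn : ConnOn G {b}ᶜ)
    (hab : a ≠ b) : ∃ l ∈ L, G.Adj l a := by
  by_contra! hcon
  have haL : a ∉ L := fun h => Set.disjoint_left.1 hL.2.1 h (by simp)
  have hbL : b ∉ L := fun h => Set.disjoint_left.1 hL.2.1 h (by simp)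
  obtain ⟨l, hl⟩ := hL.1
  refine haL ((hconn.2 l (fun h => hbL (h ▸ hl)) a hab).mem_of_closed hl ?_)
  intro p hp q hq _ hpq
  refine hL.2.2.2 p hp q ?_ hpq
  rintro (rfl | rfl)
  · exact hcon p hp hpq
  · exact hq rfl

theorem IsCompOf.disjoint_of_ne {S L : Set V} (hC : IsCompOf G S C) (hL : IsCompOf G S L)
    (hne : L ≠ C) : Disjoint L C := by
  have sub : ∀ {A B : Set V}, IsCompOf G S A → IsCompOf G S B → ∀ x ∈ A, x ∈ B → A ⊆ B := by
    intro A B hA hB x hxA hxB y hy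
    refine ((connected_induce_iff_connOn.1 hA.2.2.1).2 x hxA y hy).mem_of_closed hxB ?_
    intro p hp q hq _ hpq
    exact hB.2.2.2 p hp q (fun h => Set.disjoint_left.1 hA.2.1 hq h) hpq
  rw [Set.disjoint_left]
  intro x hxL hxC
  exact hne (Set.Subset.antisymm (sub hL hC x hxL hxC) (sub hC hL x hxC hxL))

theorem KuratowskiOn.subset_component {H : SimpleGraph V} {S : Set V} (hK : KuratowskiOn H S)
    (hH : H ≤ G) (ha : a ∉ S) (hC : IsCompOf G {a, b} C) (hmeet : ∃ x ∈ S, x ∈ C) :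
    S ⊆ C ∪ {b} := by
  have hbC : b ∉ C := fun h => Set.disjoint_left.1 hC.2.1 h (by simp)
  obtain ⟨x, hx, hxC⟩ := hmeet
  intro y hy
  by_cases hyb : y = b
  · exact Or.inr hyb
  left
  refine ((hK.conn b).2 x ⟨hx, fun h => hbC (h ▸ hxC)⟩ y ⟨hy, hyb⟩).mem_of_closed hxC ?_
  intro p hp q hq _ hpq
  refine hC.2.2.2 p hp q ?_ (hH hpq)
  rintro (h | h)
  · exact ha (h ▸ hq.1)
  · exact hq.2 h

theorem IsApexObstruction.nonplanarOn_light [Finite V] (hobs : IsApexObstruction G)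
    (hconn : ∀ z, ConnOn G {z}ᶜ) (hab : a ≠ b) (hC : IsCompOf G {a, b} C) {L : Set V}
    (hL : IsCompOf G {a, b} L) (hLC : L ≠ C) {H₁ H₂ : SimpleGraph V} {S₁ S₂ : Set V}
    (h₁ : H₁ ≤ G) (h₂ : H₂ ≤ G) (hK₁ : KuratowskiOn H₁ S₁) (hK₂ : KuratowskiOn H₂ S₂)
    (hS₁ : S₁ ⊆ C ∪ {b}) (hS₂ : S₂ ⊆ C ∪ {a}) :
    NonplanarOn (G ⊔ SimpleGraph.edge a b) Cᶜ := by
  have haC : a ∉ C := fun h => Set.disjoint_left.1 hC.2.1 h (by simp)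
  have hbC : b ∉ C := fun h => Set.disjoint_left.1 hC.2.1 h (by simp)
  have haL : a ∉ L := fun h => Set.disjoint_left.1 hL.2.1 h (by simp)
  have hbL : b ∉ L := fun h => Set.disjoint_left.1 hL.2.1 h (by simp)
  have hdis := hC.disjoint_of_ne hL hLC
  obtain ⟨l, hl⟩ := hL.1
  obtain ⟨s, hs, hsa⟩ := hL.exists_adj (hconn b) hab
  obtain ⟨t, ht, htb⟩ := IsCompOf.exists_adj (a := b) (b := a)
    (by rwa [Set.pair_comm]) (hconn a) hab.symm
  have hminor : ((G ⊔ SimpleGraph.edge a b).induce (C ∪ {a, b})).IsMinorOf G := by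
    rw [isMinorOf_iff_model]
    refine ⟨fun x => {z | z = x ∨ (z ∈ L ∧ (x : V) = a)}, ?_, ?_, ?_⟩
    · rintro ⟨x, hx⟩
      refine ConnOn.of_center (c := x) (Or.inl rfl) ?_
      rintro z (rfl | ⟨hz, hxa⟩)
      · exact ReachIn.refl _
      · obtain rfl : x = a := hxa
        refine (ReachIn.of_adj (y := s) hsa.symm (Or.inl rfl) (Or.inr ⟨hs, rfl⟩)).trans ?_
        exact ((connected_induce_iff_connOn.1 hL.2.2.1).2 s hs z hz).mono
          (fun _ _ _ _ h => h) fun y hy => Or.inr ⟨hy, rfl⟩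
    · have out : ∀ x ∈ C ∪ {a, b}, x ∉ L := by
        rintro x (h | rfl | rfl) hxL
        · exact Set.disjoint_left.1 hdis hxL h
        · exact haL hxL
        · exact hbL hxL
      rintro ⟨x, hx⟩ ⟨y, hy⟩ z (hz | ⟨hz, hzw⟩) (hz' | ⟨hz', hzw'⟩)
      · exact Subtype.ext (hz.symm.trans hz')
      · exact absurd ((show z = x from hz) ▸ hz') (out x hx)
      · exact absurd ((show z = y from hz') ▸ hz) (out y hy)
      · exact Subtype.ext (hzw.trans hzw'.symm)
    · rintro ⟨x, hx⟩ ⟨y, hy⟩ hxy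
      have hxy : (G ⊔ SimpleGraph.edge a b).Adj x y := hxy
      rcases hxy with hxy | hxy
      · exact ⟨x, Or.inl rfl, y, Or.inl rfl, hxy⟩
      · rw [SimpleGraph.edge_adj] at hxy
        rcases hxy.1 with ⟨rfl, rfl⟩ | ⟨rfl, rfl⟩
        · exact ⟨t, Or.inr ⟨ht, rfl⟩, y, Or.inl rfl, htb⟩
        · exact ⟨x, Or.inl rfl, t, Or.inr ⟨ht, rfl⟩, htb.symm⟩
  have hlC : l ∉ C ∪ {a, b} := by
    rintro (h | rfl | rfl)
    · exact Set.disjoint_left.1 hdis hl h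
    · exact haL hl
    · exact hbL hl
  obtain ⟨y, hy, hny⟩ := (hobs.isApex_induce hlC hminor).exists_vertex_induce (x := a) (by simp)
  have sub₁ : S₁ ⊆ C ∪ {a, b} := hS₁.trans (Set.union_subset_union_right _ (by simp))
  have sub₂ : S₂ ⊆ C ∪ {a, b} := hS₂.trans (Set.union_subset_union_right _ (by simp))
  have m₁ : y ∈ S₁ := by
    by_contra hyS
    exact hny (hK₁.nonplanar.mono (h₁.trans le_sup_left)
      fun x hx => ⟨sub₁ hx, fun hxy => hyS (hxy ▸ hx)⟩)
  have m₂ : y ∈ S₂ := by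
    by_contra hyS
    exact hny (hK₂.nonplanar.mono (h₂.trans le_sup_left)
      fun x hx => ⟨sub₂ hx, fun hxy => hyS (hxy ▸ hx)⟩)
  have hyC : y ∈ C := by
    rcases hS₁ m₁ with h | h
    · exact h
    rcases hS₂ m₂ with h' | h'
    · exact h'
    exact absurd (h'.symm.trans h) hab
  have hya : y ≠ a := fun h => haC (h ▸ hyC)
  have hyb : y ≠ b := fun h => hbC (h ▸ hyC)
  have hsum := (hobs.nonplanarOn_compl y).two_sum (X := C \ {y}) (M := (C ∪ {a, b})ᶜ) hab
    (fun x hx z hz hxz =>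
      hz (Or.inl (hC.2.2.2 x hx.1 z (fun h => hz (Or.inr h)) hxz)))
    (fun h => haC h.1) (fun h => hbC h.1) (by simp) (by simp)
    (Set.disjoint_left.2 fun x hx hx' => hx' (Or.inl hx.1)) (by
      intro x hx
      by_cases hxS : x ∈ C ∪ {a, b}
      · rcases hxS with h | h
        · exact Or.inl (Or.inl ⟨h, hx⟩)
        · exact Or.inr h
      · exact Or.inl (Or.inr hxS))
  rcases hsum with h | h
  · refine absurd (h.mono le_rfl ?_) hny
    rintro x (hx | hx)
    · exact ⟨Or.inl hx.1, hx.2⟩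
    · refine ⟨Or.inr hx, ?_⟩
      rintro rfl
      rcases hx with h | h
      · exact hya h
      · exact hyb h
  · refine h.mono le_rfl ?_
    rintro x (hx | rfl | rfl)
    · exact fun h => hx (Or.inl h)
    · exact haC
    · exact hbC

end Cut

/-- Two Kuratowski subgraphs of an obstruction, avoiding the vertices `a` and `b` of a cut
respectively, whose other vertices lie in the component `C`. -/
structure WitnessPair {V : Type} (G : SimpleGraph V) (a b : V) (C : Set V)
    (Ha Hb : SimpleGraph V) (SA SB : Set V) : Prop where
  obs : IsApexObstruction G
  ne : a ≠ b
  notMem_a : a ∉ C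
  notMem_b : b ∉ C
  closed : ∀ x ∈ C, ∀ y, G.Adj x y → y ∈ C ∪ {a, b}
  reach_a : ∀ x ∈ C, ∀ y ∈ C, x ≠ y → ReachIn G ((C ∪ {a}) \ {y}) x a
  reach_b : ∀ x ∈ C, ∀ y ∈ C, x ≠ y → ReachIn G ((C ∪ {b}) \ {y}) x b
  light : NonplanarOn (G ⊔ SimpleGraph.edge a b) Cᶜ
  le_a : Ha ≤ G
  le_b : Hb ≤ G
  kur_a : KuratowskiOn Ha SA
  kur_b : KuratowskiOn Hb SB
  sub_a : SA ⊆ C ∪ {b}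
  sub_b : SB ⊆ C ∪ {a}
  mem_a : b ∈ SA
  mem_b : a ∈ SB
  meet : ∃ x ∈ SA, x ∈ SB

namespace WitnessPair

variable {V : Type} {G : SimpleGraph V} {a b v w : V} {C : Set V}
  {Ha Hb : SimpleGraph V} {SA SB : Set V}

theorem a_notMem (h : WitnessPair G a b C Ha Hb SA SB) : a ∉ SA := by
  intro ha
  rcases h.sub_a ha with h' | h'
  · exact h.notMem_a h'
  · exact h.ne h'

theorem sub_a' (h : WitnessPair G a b C Ha Hb SA SB) : SA ⊆ C ∪ {a, b} :=
  h.sub_a.trans (Set.union_subset_union_right _ (by simp))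

theorem sub_b' (h : WitnessPair G a b C Ha Hb SA SB) : SB ⊆ C ∪ {a, b} :=
  h.sub_b.trans (Set.union_subset_union_right _ (by simp))

theorem reach (h : WitnessPair G a b C Ha Hb SA SB) {y : V} (hy : y ∈ C) :
    ReachIn G ((C ∪ {a, b}) \ {y}) a b := by
  obtain ⟨t, ht, htb, hty⟩ := h.kur_a.big b y
  have htC : t ∈ C := (h.sub_a ht).resolve_right htb
  refine (ReachIn.symm ?_).trans (y := t) ?_
  · exact (h.reach_a t htC y hy hty).mono (fun _ _ _ _ h => h)
      (Set.sdiff_subset_sdiff_left (Set.union_subset_union_right _ (by simp)))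
  · exact (h.reach_b t htC y hy hty).mono (fun _ _ _ _ h => h)
      (Set.sdiff_subset_sdiff_left (Set.union_subset_union_right _ (by simp)))

variable [Finite V]

theorem false_of_deleteEdges (h : WitnessPair G a b C Ha Hb SA SB) (hvw : G.Adj v w)
    (hA : ¬ Ha.Adj v w) (hB : ¬ Hb.Adj v w)
    (hr : ∀ y ∈ C, y ∈ SA → y ∈ SB →
      ReachIn (G.deleteEdges {s(v, w)}) ((C ∪ {a, b}) \ {y}) a b)
    (hvC : v ∈ C) : False := by
  obtain ⟨y, hy⟩ := (h.obs.isApex_deleteEdges hvw).exists_vertex v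
  have le : ∀ {H : SimpleGraph V}, H ≤ G → ¬ H.Adj v w → H ≤ G.deleteEdges {s(v, w)} := by
    intro H hH hn x z hxz
    rw [SimpleGraph.deleteEdges_adj]
    refine ⟨hH hxz, fun he => hn ?_⟩
    rcases Sym2.eq_iff.1 he with ⟨rfl, rfl⟩ | ⟨rfl, rfl⟩
    · exact hxz
    · exact hxz.symm
  have yA : y ∈ SA := by
    by_contra hyS
    exact hy (h.kur_a.nonplanar.mono (le h.le_a hA) fun x hx hxy => hyS (hxy ▸ hx))
  have yB : y ∈ SB := by
    by_contra hyS
    exact hy (h.kur_b.nonplanar.mono (le h.le_b hB) fun x hx hxy => hyS (hxy ▸ hx))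
  have yC : y ∈ C := (h.sub_b yB).resolve_right fun e => h.a_notMem (e ▸ yA)
  refine hy ((h.light.of_virtual_edge h.ne h.notMem_b ?_ Set.sdiff_subset (hr y yC yA yB)).mono
    le_rfl ?_)
  · intro x hx z hz hxz
    rw [SimpleGraph.deleteEdges_adj]
    refine ⟨hxz, fun he => ?_⟩
    rcases Sym2.eq_iff.1 he with ⟨rfl, rfl⟩ | ⟨rfl, rfl⟩
    · exact hx hvC
    · exact hz hvC
  · rintro x (hx | hx)
    · exact hx.2
    · rintro rfl
      exact hx yC

theorem false_of_contractEdge (h : WitnessPair G a b C Ha Hb SA SB) (hvC : v ∈ C)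
    (hvB : v ∉ SB) (hvw : G.Adj v w) (hwa : w ≠ a)
    (hA : NonplanarOn (contractEdge G w v) (collapse w v '' SA))
    (hr : w ∈ SB → w ∈ C → ReachIn G (((C ∪ {a, b}) \ {w}) \ {v}) a b) : False := by
  have hwv : w ≠ v := hvw.ne'
  have hva : v ≠ a := fun e => h.notMem_a (e ▸ hvC)
  have hvb : v ≠ b := fun e => h.notMem_b (e ▸ hvC)
  obtain ⟨y, hyv, hy⟩ := (h.obs.isApex_contractEdge hvw).exists_vertex_induce (x := w) hwv
  have hB : NonplanarOn (contractEdge G w v) SB := by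
    obtain ⟨n, K, f, hK, hf, hfS⟩ := h.kur_b.nonplanar.mono h.le_b le_rfl
    refine ⟨n, K, _, hK, hf.contractEdge hwv fun i _ hi => absurd (hfS i hi) hvB, ?_⟩
    rintro i _ ⟨x, hx, rfl⟩
    have hxB := hfS i hx
    have hxv : x ≠ v := fun e => hvB (e ▸ hxB)
    rwa [collapse_of_ne hxv]
  have yB : y ∈ SB := by
    by_contra hyS
    exact hy (hB.mono le_rfl fun x hx => ⟨fun e => hvB (e ▸ hx), fun e => hyS (e ▸ hx)⟩)
  have yA : y ∈ collapse w v '' SA := by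
    by_contra hyS
    refine hy (hA.mono le_rfl fun x hx => ⟨?_, fun e => hyS (e ▸ hx)⟩)
    obtain ⟨p, _, rfl⟩ := hx
    by_cases hp : p = v
    · rw [hp, collapse_self]; exact hwv
    · rw [collapse_of_ne hp]; exact hp
  have yC : y ∈ C := by
    refine (h.sub_b yB).resolve_right fun e => ?_
    obtain rfl : y = a := e
    obtain ⟨p, hp, hpy⟩ := yA
    by_cases hpv : p = v
    · rw [hpv, collapse_self] at hpy
      exact hwa hpy
    · rw [collapse_of_ne hpv] at hpy
      exact h.a_notMem (hpy ▸ hp)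
  have glue : ReachIn (contractEdge G w v) (((C ∪ {a, b}) \ {y}) \ {v}) a b → False := by
    intro hreach
    refine hy ((h.light.of_virtual_edge h.ne h.notMem_b ?_
      (Set.sdiff_subset.trans Set.sdiff_subset) hreach).mono le_rfl ?_)
    · intro x hx z hz hxz
      exact contractEdge_adj_of_ne (fun e => hx (e ▸ hvC)) (fun e => hz (e ▸ hvC)) hxz
    · rintro x (hx | hx)
      · exact ⟨hx.2, hx.1.2⟩
      · exact ⟨fun e => hx (e ▸ hvC), fun e => hx (e ▸ yC)⟩
  by_cases hyw : y = w
  · subst hyw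
    exact glue ((hr yB yC).mono (fun p hp q hq hpq => contractEdge_adj_of_ne hp.2 hq.2 hpq)
      subset_rfl)
  · apply glue
    have mem : ∀ p ∈ (C ∪ {a, b}) \ {y}, collapse w v p ∈ ((C ∪ {a, b}) \ {y}) \ {v} := by
      intro p hp
      by_cases hpv : p = v
      · rw [hpv, collapse_self]
        exact ⟨⟨h.closed v hvC w hvw, fun e => hyw e.symm⟩, hwv⟩
      · rw [collapse_of_ne hpv]
        exact ⟨hp, hpv⟩
    have := (h.reach yC).map (G' := contractEdge G w v) (T := ((C ∪ {a, b}) \ {y}) \ {v})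
      (collapse w v) fun p hp q hq hpq => by
        rcases collapse_adj hwv hpq with e | e
        · rw [e]; exact ReachIn.refl _
        · exact ReachIn.of_adj e (mem p hp) (mem q hq)
    rwa [collapse_of_ne hva.symm, collapse_of_ne hvb.symm] at this

theorem ne_left_of_adj (h : WitnessPair G a b C Ha Hb SA SB) (hvC : v ∈ C) (hvB : v ∉ SB)
    (hvw : G.Adj v w) : w ≠ a := by
  rintro rfl
  refine h.false_of_deleteEdges hvw (fun e => h.a_notMem (h.kur_a.supp e.symm))
    (fun e => hvB (h.kur_b.supp e)) ?_ hvC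
  intro y hy _ hyB
  have hyw : y ≠ w := fun e => h.notMem_a (e ▸ hy)
  obtain ⟨t, ht, htw, hty⟩ := h.kur_b.big w y
  have htC : t ∈ C := (h.sub_b ht).resolve_right htw
  refine (ReachIn.mono (S := SB \ {y}) ?_ (Set.sdiff_subset_sdiff_left h.sub_b')
    ((h.kur_b.conn y).2 w ⟨h.mem_b, hyw.symm⟩ t ⟨ht, hty⟩)).trans
    ((h.reach_b t htC y hy hty).mono ?_
      (Set.sdiff_subset_sdiff_left (Set.union_subset_union_right _ (by simp))))
  · intro p hp q hq hpq
    rw [SimpleGraph.deleteEdges_adj]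
    refine ⟨h.le_b hpq, fun he => ?_⟩
    rcases Sym2.eq_iff.1 he with ⟨rfl, _⟩ | ⟨_, rfl⟩
    · exact hvB hp.1
    · exact hvB hq.1
  · have out : w ∉ C ∪ {b} := by
      rintro (e | e)
      · exact h.notMem_a e
      · exact h.ne e
    intro p hp q hq hpq
    rw [SimpleGraph.deleteEdges_adj]
    refine ⟨hpq, fun he => ?_⟩
    rcases Sym2.eq_iff.1 he with ⟨_, rfl⟩ | ⟨rfl, _⟩
    · exact out hq.1
    · exact out hp.1

theorem mem_of_adj (h : WitnessPair G a b C Ha Hb SA SB) (hvC : v ∈ C) (hvB : v ∉ SB)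
    (hvw : G.Adj v w) : w ∈ SA := by
  by_contra hwA
  have hwa := h.ne_left_of_adj hvC hvB hvw
  have hvb : v ≠ b := fun e => h.notMem_b (e ▸ hvC)
  refine h.false_of_contractEdge hvC hvB hvw hwa ?_ ?_
  · obtain ⟨n, K, f, hK, hf, hfS⟩ := h.kur_a.nonplanar.mono h.le_a le_rfl
    exact ⟨n, K, _, hK, hf.contractEdge hvw.ne' fun _ j _ hj => absurd (hfS j hj) hwA,
      fun i => Set.image_mono (hfS i)⟩
  · intro _ _
    obtain ⟨p, hpA, hpB⟩ := h.meet
    have hpv : p ≠ v := fun e => hvB (e ▸ hpB)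
    have hpw : p ≠ w := fun e => hwA (e ▸ hpA)
    refine (((h.kur_b.conn w).2 a ⟨h.mem_b, hwa.symm⟩ p ⟨hpB, hpw⟩).mono
      (fun _ _ _ _ e => h.le_b e) ?_).trans
      (((h.kur_a.conn v).2 p ⟨hpA, hpv⟩ b ⟨h.mem_a, hvb.symm⟩).mono
      (fun _ _ _ _ e => h.le_a e) ?_)
    · exact fun x hx => ⟨⟨h.sub_b' hx.1, hx.2⟩, fun e => hvB (e ▸ hx.1)⟩
    · exact fun x hx => ⟨⟨h.sub_a' hx.1, fun e => hwA (e ▸ hx.1)⟩, hx.2⟩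

theorem adj_of_adj (h : WitnessPair G a b C Ha Hb SA SB) (hvC : v ∈ C) (hvA : v ∈ SA)
    (hvB : v ∉ SB) (hvw : G.Adj v w) : Ha.Adj v w := by
  by_contra hadj
  have hwA := h.mem_of_adj hvC hvB hvw
  have hle : Ha ≤ G.deleteEdges {s(v, w)} := by
    intro x z hxz
    rw [SimpleGraph.deleteEdges_adj]
    refine ⟨h.le_a hxz, fun he => hadj ?_⟩
    rcases Sym2.eq_iff.1 he with ⟨rfl, rfl⟩ | ⟨rfl, rfl⟩
    · exact hxz
    · exact hxz.symm
  refine h.false_of_deleteEdges hvw hadj (fun e => hvB (h.kur_b.supp e)) ?_ hvC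
  intro y hy _ hyB
  refine (h.reach hy).map id fun p hp q hq hpq => ?_
  by_cases he : s(p, q) = s(v, w)
  · have hpqA : p ∈ SA ∧ q ∈ SA := by
      rcases Sym2.eq_iff.1 he with ⟨rfl, rfl⟩ | ⟨rfl, rfl⟩
      · exact ⟨hvA, hwA⟩
      · exact ⟨hwA, hvA⟩
    exact ((h.kur_a.conn y).2 p ⟨hpqA.1, hp.2⟩ q ⟨hpqA.2, hq.2⟩).mono
      (fun _ _ _ _ e => hle e) (Set.sdiff_subset_sdiff_left h.sub_a')
  · refine ReachIn.of_adj ?_ hp hq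
    rw [SimpleGraph.deleteEdges_adj]
    exact ⟨hpq, he⟩

theorem false_of_degree_two (h : WitnessPair G a b C Ha Hb SA SB) (hvC : v ∈ C) (hvA : v ∈ SA)
    (hvB : v ∉ SB) (hvw : G.Adj v w) {u : V}
    (hdeg : (∀ x, Ha.Adj v x → x = w ∨ x = u) ∨ ∀ x, Ha.Adj w x → x = v ∨ x = u) : False := by
  have hadj := h.adj_of_adj hvC hvA hvB hvw
  have hva : v ≠ a := fun e => h.notMem_a (e ▸ hvC)
  have hvb : v ≠ b := fun e => h.notMem_b (e ▸ hvC)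
  refine h.false_of_contractEdge hvC hvB hvw (h.ne_left_of_adj hvC hvB hvw) ?_ ?_
  · obtain ⟨n, K, f, hK, hf, hfS⟩ := h.kur_a.nonplanar
    obtain ⟨f', hf', hsplit, hfS'⟩ : ∃ f', Model K Ha f' ∧
        (∀ i j, v ∈ f' i → w ∈ f' j → i = j) ∧ ∀ i, f' i ⊆ SA := by
      rcases hdeg with hdeg | hdeg
      · exact hf.exists_not_split hK hadj hdeg hfS
      · obtain ⟨f', h1, h2, h3⟩ := hf.exists_not_split hK hadj.symm hdeg hfS
        exact ⟨f', h1, fun i j hi hj => (h2 j i hj hi).symm, h3⟩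
    have := hf'.contractEdge hvw.ne' hsplit
    exact NonplanarOn.mono (contractEdge_mono h.le_a w v) le_rfl
      ⟨n, K, _, hK, this, fun i => Set.image_mono (hfS' i)⟩
  · intro hwB hwC
    have hwb : w ≠ b := fun e => h.notMem_b (e ▸ hwC)
    have hconn : ConnOn Ha ((SA \ {w}) \ {v}) := by
      rcases hdeg with hdeg | hdeg
      · refine (h.kur_a.conn w).sdiff_leaf (u := u) ⟨b, ⟨h.mem_a, hwb.symm⟩, hvb.symm⟩ ?_
        exact fun x hx hvx => (hdeg x hvx).resolve_left hx.2
      · rw [Set.sdiff_sdiff_comm]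
        refine (h.kur_a.conn v).sdiff_leaf (u := u) ⟨b, ⟨h.mem_a, hvb.symm⟩, hwb.symm⟩ ?_
        exact fun x hx hvx => (hdeg x hvx).resolve_left hx.2
    have key : ∀ z, ReachIn G ((C ∪ {a, b}) \ {w}) a z →
        (z ≠ v ∧ ReachIn G (((C ∪ {a, b}) \ {w}) \ {v}) a z) ∨
          ReachIn G (((C ∪ {a, b}) \ {w}) \ {v}) a b := by
      intro z hz
      induction hz with
      | refl => exact Or.inl ⟨hva.symm, ReachIn.refl _⟩
      | @tail p q _ hpq ih =>
        rcases ih with ⟨hpv, ih⟩ | ih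
        swap
        · exact Or.inr ih
        obtain ⟨hpq, hp, hq⟩ := hpq
        by_cases hqv : q = v
        · subst hqv
          right
          have hpA := h.mem_of_adj hvC hvB hpq.symm
          refine ih.trans ((hconn.2 p ⟨⟨hpA, hp.2⟩, hpv⟩ b ⟨⟨h.mem_a, hwb.symm⟩, hvb.symm⟩).mono
            (fun _ _ _ _ e => h.le_a e) ?_)
          exact fun x hx => ⟨⟨h.sub_a' hx.1.1, hx.1.2⟩, hx.2⟩
        · exact Or.inl ⟨hqv, ih.trans (ReachIn.of_adj hpq ⟨hp, hpv⟩ ⟨hq, hqv⟩)⟩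
    rcases key b (h.reach hwC) with e | e
    · exact e.2
    · exact e

end WitnessPair

theorem isBranchVertex_of_adj {V : Type} [Finite V] {G : SimpleGraph V} {H : G.Subgraph}
    {x w : V} (hxw : H.Adj x w) (hdeg : ∀ u, ¬ ∀ y, H.Adj x y → y = w ∨ y = u) :
    IsBranchVertex H x := by
  refine ⟨hxw.fst_mem, ?_⟩
  obtain ⟨u, hu⟩ := not_forall.1 (hdeg w)
  rw [Classical.not_imp, not_or] at hu
  obtain ⟨t, ht⟩ := not_forall.1 (hdeg u)
  rw [Classical.not_imp, not_or] at ht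
  have hsub : ({w, u, t} : Set V) ⊆ H.neighborSet x := by
    rintro y (rfl | rfl | rfl)
    · exact hxw
    · exact hu.1
    · exact ht.1
  have hcard : ({w, u, t} : Set V).ncard = 3 :=
    Set.ncard_eq_three.2 ⟨w, u, t, Ne.symm hu.2.1, Ne.symm ht.2.1, Ne.symm ht.2.2, rfl⟩
  rw [← hcard]
  exact Set.ncard_le_ncard hsub (Set.toFinite _)

theorem connOn_of_vConn_eq_two {V : Type} [Fintype V] {G : SimpleGraph V} (hk : vConn G = 2) :
    ConnOn G Set.univ ∧ ∀ z, ConnOn G {z}ᶜ := by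
  have hmem : 2 ∈ {k : ℕ | ∀ s : Finset V, s.card < k →
      (G.induce ((↑s : Set V)ᶜ)).Connected} := by
    rw [← hk]
    refine Nat.sSup_mem ⟨0, fun s hs => absurd hs (Nat.not_lt_zero _)⟩ ?_
    by_contra hb
    have : vConn G = 0 := Nat.sSup_of_not_bddAbove hb
    omega
  refine ⟨?_, fun z => ?_⟩
  · simpa using connected_induce_iff_connOn.1 (hmem ∅ (by simp))
  · simpa using connected_induce_iff_connOn.1 (hmem {z} (by simp))

/-- The vertices of a witness for `a` that avoid a witness for `b`. -/
theorem isBranchVertex_of_exclusive {V : Type} [Fintype V] (G : SimpleGraph V) (a b : V)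
    (C L : Set V) (hobs : IsApexObstruction G) (hk : vConn G = 2)
    (huniq : ∀ T : Set V, IsTwoCut G T → T = ({a, b} : Set V)) (hab : a ≠ b)
    (hheavy : IsHeavyComp G a b C) (hL : IsCompOf G {a, b} L) (hLC : L ≠ C)
    (hplanarC : IsPlanar (G.induce C)) (Ha Hb : G.Subgraph)
    (hHa : IsKuratowskiWitness G a Ha) (hHb : IsKuratowskiWitness G b Hb) :
    ∀ v : V, v ∈ Ha.verts → v ∉ Hb.verts → v ≠ a → v ≠ b →
      IsBranchVertex Ha v ∧ ∀ w : V, G.Adj v w → IsBranchVertex Ha w := by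
  obtain ⟨hconn, hconn1⟩ := connOn_of_vConn_eq_two hk
  obtain ⟨hC, ⟨Ha', hHa', hsubA'⟩, ⟨Hb', hHb', hsubB'⟩⟩ := hheavy
  have hC' : IsCompOf G {b, a} C := by rwa [Set.pair_comm]
  have haC : a ∉ C := fun h => Set.disjoint_left.1 hC.2.1 h (by simp)
  have hbC : b ∉ C := fun h => Set.disjoint_left.1 hC.2.1 h (by simp)
  have kA := hHa.1.kuratowskiOn
  have kB := hHb.1.kuratowskiOn
  have meetA : ∃ x ∈ Ha.verts, x ∈ C := by
    obtain ⟨x, hx, hx'⟩ := hobs.exists_mem_inter hconn Ha.spanningCoe_le Hb'.spanningCoe_le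
      kA hHb'.1.kuratowskiOn
    refine ⟨x, hx, ?_⟩
    rcases hsubB' hx' with h | rfl | rfl
    · exact h
    · exact absurd hx hHa.2
    · exact absurd hx' hHb'.2
  have meetB : ∃ x ∈ Hb.verts, x ∈ C := by
    obtain ⟨x, hx, hx'⟩ := hobs.exists_mem_inter hconn Hb.spanningCoe_le Ha'.spanningCoe_le
      kB hHa'.1.kuratowskiOn
    refine ⟨x, hx, ?_⟩
    rcases hsubA' hx' with h | rfl | rfl
    · exact h
    · exact absurd hx' hHa'.2
    · exact absurd hx hHb.2
  have subA := kA.subset_component Ha.spanningCoe_le hHa.2 hC meetA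
  have subB := kB.subset_component Hb.spanningCoe_le hHb.2 hC' meetB
  have notC : ∀ {H : SimpleGraph V} {S : Set V}, H ≤ G → KuratowskiOn H S → ¬ S ⊆ C :=
    fun hle hK hS => (hK.nonplanar.mono hle hS).not_isPlanar_induce hplanarC
  have memA : b ∈ Ha.verts := by
    by_contra hb
    exact notC Ha.spanningCoe_le kA fun x hx =>
      (subA hx).resolve_right fun e => hb (e ▸ hx)
  have memB : a ∈ Hb.verts := by
    by_contra ha
    exact notC Hb.spanningCoe_le kB fun x hx =>
      (subB hx).resolve_right fun e => ha (e ▸ hx)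
  have hW : WitnessPair G a b C Ha.spanningCoe Hb.spanningCoe Ha.verts Hb.verts :=
    { obs := hobs
      ne := hab
      notMem_a := haC
      notMem_b := hbC
      closed := fun x hx y hxy => by
        by_cases hy : y ∈ ({a, b} : Set V)
        · exact Or.inr hy
        · exact Or.inl (hC.2.2.2 x hx y hy hxy)
      reach_a := fun x hx y hy hxy => ReachIn.through_component hC huniq hx hy hxy hab
      reach_b := fun x hx y hy hxy => ReachIn.through_component hC'
        (fun T hT => (huniq T hT).trans (Set.pair_comm a b)) hx hy hxy hab.symm
      light := hobs.nonplanarOn_light hconn1 hab hC hL hLC Ha.spanningCoe_le Hb.spanningCoe_le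
        kA kB subA subB
      le_a := Ha.spanningCoe_le
      le_b := Hb.spanningCoe_le
      kur_a := kA
      kur_b := kB
      sub_a := subA
      sub_b := subB
      mem_a := memA
      mem_b := memB
      meet := hobs.exists_mem_inter hconn Ha.spanningCoe_le Hb.spanningCoe_le kA kB }
  intro v hvA hvB hva hvb
  have hvC : v ∈ C := (subA hvA).resolve_right hvb
  have hnbr : ∀ w, G.Adj v w → IsBranchVertex Ha v ∧ IsBranchVertex Ha w := by
    intro w hvw
    have hadj : Ha.Adj v w := hW.adj_of_adj hvC hvA hvB hvw
    exact ⟨isBranchVertex_of_adj hadj fun u hu =>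
        hW.false_of_degree_two hvC hvA hvB hvw (u := u) (Or.inl hu),
      isBranchVertex_of_adj hadj.symm fun u hu =>
        hW.false_of_degree_two hvC hvA hvB hvw (u := u) (Or.inr hu)⟩
  refine ⟨?_, fun w hvw => (hnbr w hvw).2⟩
  rcases Relation.ReflTransGen.cases_head (hconn.2 v trivial b trivial) with h | ⟨c, hc, _⟩
  · exact absurd h hvb
  · exact (hnbr c hc.1).1

/-- A vertex of exactly one of the two witnesses (other than `a`, `b`), together with all
its neighbors, consists of branch vertices of that witness. -/
theorem exclusive_vertex_branch {V : Type} [Fintype V] (G : SimpleGraph V) (a b : V) (C L : Set V)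
    (hobs : IsApexObstruction G)
    (hk : vConn G = 2)
    (hcut : IsTwoCut G {a, b})
    (huniq : ∀ T : Set V, IsTwoCut G T → T = ({a, b} : Set V))
    (hab : a ≠ b)
    (hheavy : IsHeavyComp G a b C)
    (hlight : IsCompOf G {a, b} L) (hLC : L ≠ C)
    (hplanarC : IsPlanar (G.induce C))
    (Ha Hb : G.Subgraph)
    (hHa : IsKuratowskiWitness G a Ha) (hHb : IsKuratowskiWitness G b Hb) :
    (∀ v : V, v ∈ Ha.verts → v ∉ Hb.verts → v ≠ a → v ≠ b →
      IsBranchVertex Ha v ∧ ∀ w : V, G.Adj v w → IsBranchVertex Ha w) ∧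
    (∀ v : V, v ∈ Hb.verts → v ∉ Ha.verts → v ≠ a → v ≠ b →
      IsBranchVertex Hb v ∧ ∀ w : V, G.Adj v w → IsBranchVertex Hb w) := by
  exact ⟨isBranchVertex_of_exclusive G a b C L hobs hk huniq hab hheavy hlight hLC hplanarC Ha Hb
      hHa hHb,
    fun v hvB hvA hva hvb => isBranchVertex_of_exclusive G b a C L hobs hk
      (fun T hT => (huniq T hT).trans (Set.pair_comm a b)) hab.symm
      ⟨by rw [Set.pair_comm]; exact hheavy.1, by rw [Set.pair_comm]; exact hheavy.2.2,
        by rw [Set.pair_comm]; exact hheavy.2.1⟩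
      (by rwa [Set.pair_comm]) hLC hplanarC Hb Ha hHb hHa v hvB hvA hvb hva⟩
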